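/- arXiv:0809.1546 — 3 statements merged into one kernel-verified Lean document; each statement's English description precedes it below -/
import Mathlib

section
/- Let n ≥ 1 and let G be an infinite discrete subgroup of PU(1,n). Then the complement ℙⁿ_ℂ ∖ Eq(G) of the equicontinuity region of G equals the union ⋃_{p ∈ Λ_CG(G)} 𝓗_p of all complex projective hyperplanes tangent to ∂𝐇ⁿ_ℂ at points of the Chen–Greenberg limit set Λ_CG(G). -/
open Filter Topology Matrix

noncomputable section

abbrev Vec (n : ℕ) := Fin (n + 1) → ℂ
abbrev Mat (n : ℕ) := Matrix (Fin (n + 1)) (Fin (n + 1)) ℂ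
abbrev Pn (n : ℕ) := Projectivization ℂ (Vec n)

instance (n : ℕ) : TopologicalSpace (Pn n) :=
  inferInstanceAs (TopologicalSpace (Quotient (projectivizationSetoid ℂ (Vec n))))

def herm (n : ℕ) (u v : Vec n) : ℂ :=
  -(u 0 * (starRingEnd ℂ) (v 0)) + ∑ j : Fin n, u j.succ * (starRingEnd ℂ) (v j.succ)

def Hball (n : ℕ) : Set (Pn n) :=
  {p | ∃ v : Vec n, ∃ hv : v ≠ 0, p = Projectivization.mk ℂ v hv ∧ (herm n v v).re < 0}

def Hbdry (n : ℕ) : Set (Pn n) :=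
  {p | ∃ v : Vec n, ∃ hv : v ≠ 0, p = Projectivization.mk ℂ v hv ∧ herm n v v = 0}

abbrev GLn (n : ℕ) := Matrix.GeneralLinearGroup (Fin (n + 1)) ℂ
abbrev PGLn (n : ℕ) := GLn n ⧸ Subgroup.center (GLn n)

lemma glInj {n : ℕ} (A : GLn n) : Function.Injective (Matrix.mulVecLin (A : Mat n)) := by
  intro x y h
  simp only [Matrix.mulVecLin_apply] at h
  have h2 : ((A⁻¹ : GLn n) : Mat n) *ᵥ ((A : Mat n) *ᵥ x)
      = ((A⁻¹ : GLn n) : Mat n) *ᵥ ((A : Mat n) *ᵥ y) := by rw [h]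
  rwa [Matrix.mulVec_mulVec, Matrix.mulVec_mulVec, Units.inv_mul, Matrix.one_mulVec,
    Matrix.one_mulVec] at h2

def actGL {n : ℕ} (A : GLn n) : Pn n → Pn n :=
  Projectivization.map (Matrix.mulVecLin (A : Mat n)) (glInj A)

def act {n : ℕ} (g : PGLn n) : Pn n → Pn n := actGL (Quotient.out g)

-- part 2 --

/-- The subset `U(1,n)` of `GL(n+1,ℂ)`: matrices preserving the Hermitian form. -/
def unitaryGL (n : ℕ) : Set (GLn n) :=
  {A | ∀ u v : Vec n, herm n ((A : Mat n) *ᵥ u) ((A : Mat n) *ᵥ v) = herm n u v}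

/-- `PU(1,n)`, the image of `U(1,n)` in `PGL(n+1,ℂ)`. -/
def PUset (n : ℕ) : Set (PGLn n) := (QuotientGroup.mk : GLn n → PGLn n) '' unitaryGL n

/-- The center of the ball `𝐇ⁿ_ℂ`, namely the image of `(1,0,…,0)`. -/
def basePt (n : ℕ) : Pn n :=
  Projectivization.mk ℂ (Pi.single 0 1) (by
    intro h
    have := congrFun h 0
    simp [Pi.single_eq_same] at this)

lemma basePt_mem_Hball (n : ℕ) : basePt n ∈ Hball n := by
  refine ⟨Pi.single 0 1, _, rfl, ?_⟩
  have : herm n (Pi.single 0 1) (Pi.single 0 1) = -1 := by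
    simp [herm, Pi.single_eq_same, Pi.single_eq_of_ne (Fin.succ_ne_zero _)]
  rw [this]
  norm_num

/-- The set of accumulation points of the orbit `G • x` in `ℙⁿ_ℂ`: limits of
`g_m • x` along sequences of pairwise distinct elements of `G`. -/
def accPts {n : ℕ} (G : Subgroup (PGLn n)) (x : Pn n) : Set (Pn n) :=
  {z | ∃ g : ℕ → G, Function.Injective g ∧
    Tendsto (fun m => act (g m : PGLn n) x) atTop (𝓝 z)}

/-- The Chen–Greenberg limit set of `G`. -/
def LambdaCG {n : ℕ} (G : Subgroup (PGLn n)) : Set (Pn n) := accPts G (basePt n)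

/-- Uniform convergence on `K` of a sequence of self-maps of `ℙⁿ_ℂ` to `F`, expressed
via open neighborhoods of the diagonal.  Since `ℙⁿ_ℂ` is compact Hausdorff, this is
equivalent to uniform convergence on `K` with respect to any metric inducing its
topology. -/
def UnifConvOn {n : ℕ} (f : ℕ → Pn n → Pn n) (F : Pn n → Pn n) (K : Set (Pn n)) : Prop :=
  ∀ W : Set (Pn n × Pn n), IsOpen W → (∀ y, (y, y) ∈ W) →
    ∀ᶠ m in atTop, ∀ x ∈ K, (F x, f m x) ∈ W

/-- Uniform convergence on all compact subsets of `S`. -/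
def UnifConvOnCompacts {n : ℕ} (f : ℕ → Pn n → Pn n) (F : Pn n → Pn n)
    (S : Set (Pn n)) : Prop :=
  ∀ K ⊆ S, IsCompact K → UnifConvOn f F K

/-- The equicontinuity region of a subgroup `G ≤ PGL(n+1,ℂ)`: points having an open
neighborhood `U` on which every sequence in `G` has a subsequence converging uniformly
on compact subsets of `U`. -/
def eqRegion {n : ℕ} (G : Subgroup (PGLn n)) : Set (Pn n) :=
  {z | ∃ U : Set (Pn n), IsOpen U ∧ z ∈ U ∧
    ∀ g : ℕ → G, ∃ φ : ℕ → ℕ, StrictMono φ ∧ ∃ F : Pn n → Pn n,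
      UnifConvOnCompacts (fun m => act (g (φ m) : PGLn n)) F U}

/-- The equicontinuity region of the family of maps `{f m : m ∈ ℕ}`. -/
def eqRegionFam {n : ℕ} (f : ℕ → Pn n → Pn n) : Set (Pn n) :=
  {z | ∃ U : Set (Pn n), IsOpen U ∧ z ∈ U ∧
    ∀ s : ℕ → ℕ, ∃ φ : ℕ → ℕ, StrictMono φ ∧ ∃ F : Pn n → Pn n,
      UnifConvOnCompacts (fun k => f (s (φ k))) F U}

/-- The projectivization of a linear subspace `W ⊆ ℂ^{n+1}`, as a subset of `ℙⁿ_ℂ`. -/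
def projSet {n : ℕ} (W : Submodule ℂ (Vec n)) : Set (Pn n) := {p | p.rep ∈ W}

/-- A complex projective hyperplane: the projectivization of an `n`-dimensional
subspace of `ℂ^{n+1}`. -/
def IsProjHyperplane {n : ℕ} (S : Set (Pn n)) : Prop :=
  ∃ W : Submodule ℂ (Vec n), Module.finrank ℂ W = n ∧ S = projSet W

/-- A complex projective line: the projectivization of a `2`-dimensional subspace. -/
def IsProjLine {n : ℕ} (S : Set (Pn n)) : Prop :=
  ∃ W : Submodule ℂ (Vec n), Module.finrank ℂ W = 2 ∧ S = projSet W

/-- The kernel in `ℙⁿ_ℂ` of the quasi-projective map induced by the nonzero matrix `M`. -/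
def qKer {n : ℕ} (M : Mat n) : Set (Pn n) := projSet (LinearMap.ker (Matrix.mulVecLin M))

/-- The image in `ℙⁿ_ℂ` of the quasi-projective map induced by the nonzero matrix `M`. -/
def qIm {n : ℕ} (M : Mat n) : Set (Pn n) := projSet (LinearMap.range (Matrix.mulVecLin M))

/-- The quasi-projective map `ℙⁿ_ℂ ∖ Ker(M) → ℙⁿ_ℂ` induced by the nonzero matrix `M`
(extended to all of `ℙⁿ_ℂ` by the identity on `Ker(M)`, where it is irrelevant). -/
def qMap {n : ℕ} (M : Mat n) : Pn n → Pn n := fun p =>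
  if h : M *ᵥ p.rep ≠ 0 then Projectivization.mk ℂ (M *ᵥ p.rep) h else p

/-- Convergence of a sequence of transformations of `ℙⁿ_ℂ` to the quasi-projective map
induced by `M`, in the sense of quasi-projective transformations: uniform convergence
on compact subsets of `ℙⁿ_ℂ ∖ Ker(M)`. -/
def QPConv {n : ℕ} (f : ℕ → Pn n → Pn n) (M : Mat n) : Prop :=
  UnifConvOnCompacts f (qMap M) (qKer M)ᶜ

/-- The special linear group `SL(n+1,ℂ)`. -/
abbrev SLn (n : ℕ) := Matrix.SpecialLinearGroup (Fin (n + 1)) ℂ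

/-- The projective special linear group `PSL(n+1,ℂ) = SL(n+1,ℂ)/center`. -/
abbrev PSLn (n : ℕ) := SLn n ⧸ Subgroup.center (SLn n)

/-- The projective transformation induced by an element of `SL(n+1,ℂ)`. -/
def actSL {n : ℕ} (A : SLn n) : Pn n → Pn n := actGL (Matrix.SpecialLinearGroup.toGL A)

/-- The projective transformation induced by an element of `PSL(n+1,ℂ)` (via an
arbitrary representative; all representatives induce the same transformation). -/
def actPSL {n : ℕ} (g : PSLn n) : Pn n → Pn n := actSL (Quotient.out g)

/-- The projective hyperplane tangent to `∂𝐇ⁿ_ℂ` at `p`: the projectivization of the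
Hermitian orthogonal complement of a lift of `p`. -/
def tangentAt {n : ℕ} (p : Pn n) : Set (Pn n) := {q | herm n q.rep p.rep = 0}

end

section ProjectivePoints

/-- The point of `ℙⁿ_ℂ` spanned by a nonzero vector (with a junk value at `0`). -/
noncomputable def linePt {n : ℕ} (v : Vec n) : Pn n :=
  open Classical in if h : v ≠ 0 then Projectivization.mk ℂ v h else basePt n

lemma linePt_of_ne_zero {n : ℕ} {v : Vec n} (h : v ≠ 0) :
    linePt v = Projectivization.mk ℂ v h := by
  simp [linePt, h]

lemma linePt_rep {n : ℕ} (p : Pn n) : linePt p.rep = p := by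
  rw [linePt_of_ne_zero p.rep_nonzero, Projectivization.mk_rep]

lemma linePt_smul {n : ℕ} {c : ℂ} (hc : c ≠ 0) (v : Vec n) : linePt (c • v) = linePt v := by
  by_cases h : v = 0
  · simp [h]
  · rw [linePt_of_ne_zero h, linePt_of_ne_zero (smul_ne_zero hc h),
      Projectivization.mk_eq_mk_iff']
    exact ⟨c, rfl⟩

lemma exists_rep_linePt {n : ℕ} {v : Vec n} (h : v ≠ 0) :
    ∃ c : ℂ, c ≠ 0 ∧ (linePt v).rep = c • v := by
  have h1 : Projectivization.mk ℂ (linePt v).rep (linePt v).rep_nonzero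
      = Projectivization.mk ℂ v h := by
    rw [Projectivization.mk_rep, linePt_of_ne_zero h]
  obtain ⟨a, ha⟩ := (Projectivization.mk_eq_mk_iff ℂ _ _ _ _).1 h1
  exact ⟨a, a.ne_zero, ha.symm⟩

lemma isOpen_linePt_image {n : ℕ} {U : Set (Vec n)} (hU : IsOpen U) (h0 : (0 : Vec n) ∉ U) :
    IsOpen (linePt '' U) := by
  have key : ∀ x : {v : Vec n // v ≠ 0},
      (Quotient.mk (projectivizationSetoid ℂ (Vec n)) x ∈ linePt '' U) ↔
        ∃ c : ℂˣ, (c : ℂ) • (x : Vec n) ∈ U := by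
    rintro ⟨x, hx⟩
    change Projectivization.mk ℂ x hx ∈ linePt '' U ↔ _
    constructor
    · rintro ⟨u, hu, hux⟩
      have hu0 : u ≠ 0 := fun h => h0 (h ▸ hu)
      rw [linePt_of_ne_zero hu0, Projectivization.mk_eq_mk_iff] at hux
      obtain ⟨a, ha⟩ := hux
      exact ⟨a, by rw [← ha] at hu; exact hu⟩
    · rintro ⟨c, hc⟩
      exact ⟨_, hc, by rw [linePt_smul c.ne_zero, linePt_of_ne_zero hx]⟩
  have : IsOpen ((Quotient.mk (projectivizationSetoid ℂ (Vec n))) ⁻¹' (linePt '' U)) := by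
    have h2 : (Quotient.mk (projectivizationSetoid ℂ (Vec n))) ⁻¹' (linePt '' U)
        = ⋃ c : ℂˣ, (fun x : {v : Vec n // v ≠ 0} => (c : ℂ) • (x : Vec n)) ⁻¹' U := by
      ext x
      simp only [Set.mem_preimage, Set.mem_iUnion]
      exact key x
    rw [h2]
    exact isOpen_iUnion fun c => hU.preimage (by fun_prop)
  exact this

lemma continuousAt_linePt {n : ℕ} {v : Vec n} (h : v ≠ 0) : ContinuousAt linePt v := by
  have hopen : IsOpen {v : Vec n | v ≠ 0} := isOpen_ne
  have hc : ContinuousOn (linePt (n := n)) {v : Vec n | v ≠ 0} := by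
    rw [continuousOn_iff_continuous_domRestrict]
    have : Set.domRestrict {v : Vec n | v ≠ 0} linePt
        = Quotient.mk (projectivizationSetoid ℂ (Vec n)) := by
      ext1 x
      exact linePt_of_ne_zero x.2
    rw [this]
    exact continuous_quot_mk
  exact hc.continuousAt (hopen.mem_nhds h)

lemma map_linePt_nhds {n : ℕ} {v : Vec n} (h : v ≠ 0) : map linePt (𝓝 v) = 𝓝 (linePt v) := by
  refine le_antisymm (continuousAt_linePt h) fun s hs => ?_
  have h1 : (linePt ⁻¹' s) ∩ {v : Vec n | v ≠ 0} ∈ 𝓝 v :=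
    inter_mem hs (isOpen_ne.mem_nhds h)
  obtain ⟨U, hUs, hU, hvU⟩ := mem_nhds_iff.1 h1
  refine mem_of_superset ((isOpen_linePt_image hU fun h0 => (hUs h0).2 rfl).mem_nhds
    (Set.mem_image_of_mem _ hvU)) ?_
  rintro _ ⟨u, hu, rfl⟩
  exact (hUs hu).1

lemma eventually_nhds_prod_linePt {n : ℕ} {X : Type*} [TopologicalSpace X] {a : X} {v : Vec n}
    (h : v ≠ 0) {P : X × Pn n → Prop} :
    (∀ᶠ q in 𝓝 (a, linePt v), P q) ↔ ∀ᶠ q in 𝓝 (a, v), P (q.1, linePt q.2) := by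
  rw [nhds_prod_eq, ← map_linePt_nhds h, prod_map_right, eventually_map, ← nhds_prod_eq]
  rfl

/-- The partially defined action of matrices on `ℙⁿ_ℂ`. -/
noncomputable def matAct {n : ℕ} (M : Mat n) (p : Pn n) : Pn n := linePt (M *ᵥ p.rep)

lemma matAct_linePt {n : ℕ} (M : Mat n) {v : Vec n} (h : v ≠ 0) :
    matAct M (linePt v) = linePt (M *ᵥ v) := by
  obtain ⟨c, hc, hv⟩ := exists_rep_linePt h
  rw [matAct, hv, Matrix.mulVec_smul, linePt_smul hc]

lemma matAct_smul {n : ℕ} {c : ℂ} (hc : c ≠ 0) (M : Mat n) : matAct (c • M) = matAct M := by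
  ext1 p
  rw [matAct, matAct, Matrix.smul_mulVec, linePt_smul hc]

lemma act_mk {n : ℕ} (A : GLn n) : act (A : PGLn n) = matAct (A : Mat n) := by
  ext1 p
  obtain ⟨z, hz⟩ := QuotientGroup.mk_out_eq_mul (Subgroup.center (GLn n)) A
  obtain ⟨a, ha⟩ := Matrix.GeneralLinearGroup.mem_center_iff_val_mem_range_scalar.1 z.2
  have hA : ((Quotient.out (A : PGLn n) : GLn n) : Mat n) = a • (A : Mat n) := by
    rw [hz, Units.val_mul, ← ha]
    simp [← Matrix.smul_eq_mul_diagonal]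
  have hp : (Quotient.out (A : PGLn n) : GLn n).1 *ᵥ p.rep ≠ 0 := by
    intro h0
    exact p.rep_nonzero (glInj (Quotient.out (A : PGLn n)) (by simpa using h0))
  have ha0 : a ≠ 0 := by
    rintro rfl
    rw [hA] at hp
    simp at hp
  rw [← matAct_smul ha0, ← hA, matAct, linePt_of_ne_zero hp, act, actGL]
  conv_lhs => rw [← Projectivization.mk_rep p, Projectivization.map_mk]
  rfl

lemma eventually_matAct_near {n : ℕ} {B : Mat n} {K : Set (Pn n)} (hK : IsCompact K)
    (hB : ∀ p ∈ K, B *ᵥ p.rep ≠ 0) {W : Set (Pn n × Pn n)} (hW : IsOpen W)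
    (hdiag : ∀ y, (y, y) ∈ W) :
    ∀ᶠ M in 𝓝 B, ∀ p ∈ K, (matAct B p, matAct M p) ∈ W := by
  refine hK.eventually_forall_of_forall_eventually
    (P := fun M p => (matAct B p, matAct M p) ∈ W) fun p hp => ?_
  rw [← linePt_rep p, eventually_nhds_prod_linePt p.rep_nonzero]
  have h0 : ∀ᶠ q : Mat n × Vec n in 𝓝 (B, p.rep), q.2 ≠ 0 :=
    continuousAt_snd.eventually_ne p.rep_nonzero
  have hcont : ContinuousAt (fun q : Mat n × Vec n => (linePt (B *ᵥ q.2), linePt (q.1 *ᵥ q.2)))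
      (B, p.rep) := by
    refine ContinuousAt.prodMk ?_ ?_
    · exact ContinuousAt.comp (f := fun q : Mat n × Vec n => B *ᵥ q.2)
        (continuousAt_linePt (hB p hp)) (by fun_prop)
    · exact ContinuousAt.comp (f := fun q : Mat n × Vec n => q.1 *ᵥ q.2)
        (continuousAt_linePt (hB p hp)) (by fun_prop)
  filter_upwards [h0, hcont.preimage_mem_nhds (hW.mem_nhds (hdiag _))] with q hq0 hq
  rw [matAct_linePt _ hq0, matAct_linePt _ hq0]
  exact hq

lemma isOpen_setOf_forall_mulVec_rep_ne_zero {n : ℕ} {K : Set (Mat n)} (hK : IsCompact K) :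
    IsOpen {p : Pn n | ∀ B ∈ K, B *ᵥ p.rep ≠ 0} := by
  rw [isOpen_iff_mem_nhds]
  intro p hp
  have hvec : ∀ᶠ v in 𝓝 p.rep, ∀ B ∈ K, B *ᵥ v ≠ 0 := by
    refine hK.eventually_forall_of_forall_eventually fun B hB => ?_
    exact ContinuousAt.eventually_ne (g := fun q : Vec n × Mat n => q.2 *ᵥ q.1)
      (by fun_prop) (hp B hB)
  rw [← linePt_rep p, ← map_linePt_nhds p.rep_nonzero, mem_map]
  filter_upwards [hvec, isOpen_ne.mem_nhds p.rep_nonzero] with v hv hv0 B hB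
  obtain ⟨c, hc, hvc⟩ := exists_rep_linePt hv0
  rw [hvc, Matrix.mulVec_smul]
  exact smul_ne_zero hc (hv B hB)

lemma continuous_of_homogeneous {n : ℕ} {X : Type*} [TopologicalSpace X] {f : Vec n → X}
    (hf : ∀ v, v ≠ 0 → ContinuousAt f v) (hsmul : ∀ c : ℂ, c ≠ 0 → ∀ v, f (c • v) = f v) :
    Continuous fun p : Pn n => f p.rep := by
  rw [continuous_iff_continuousAt]
  intro p
  have h : ∀ v : Vec n, v ≠ 0 → f (linePt v).rep = f v := fun v hv => by
    obtain ⟨c, hc, hvc⟩ := exists_rep_linePt hv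
    rw [hvc, hsmul c hc]
  rw [ContinuousAt]
  nth_rw 1 [← linePt_rep p]
  rw [← map_linePt_nhds p.rep_nonzero, tendsto_map'_iff]
  refine (hf _ p.rep_nonzero).tendsto.congr' ?_
  filter_upwards [isOpen_ne.mem_nhds p.rep_nonzero] with v hv
  exact (h v hv).symm

end ProjectivePoints

section HermitianForm

/-- The Gram matrix of the form `herm`. -/
def hermGram (n : ℕ) : Mat n := Matrix.diagonal (Fin.cons (-1) fun _ => 1)

lemma hermGram_mul_hermGram (n : ℕ) : hermGram n * hermGram n = 1 := by
  rw [hermGram, Matrix.diagonal_mul_diagonal, ← Matrix.diagonal_one]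
  congr 1
  ext i
  refine Fin.cases ?_ (fun j => ?_) i <;> simp

lemma hermGram_conjTranspose (n : ℕ) : (hermGram n)ᴴ = hermGram n := by
  rw [hermGram, Matrix.diagonal_conjTranspose]
  congr 1
  ext i
  refine Fin.cases ?_ (fun j => ?_) i <;> simp

lemma herm_eq_dotProduct {n : ℕ} (u v : Vec n) : herm n u v = (hermGram n *ᵥ u) ⬝ᵥ star v := by
  simp [herm, hermGram, dotProduct, Fin.sum_univ_succ, Matrix.mulVec_diagonal]

/-- The adjoint of a matrix with respect to `herm`. -/
def hermAdj {n : ℕ} (M : Mat n) : Mat n := hermGram n * Mᴴ * hermGram n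

lemma hermAdj_hermAdj {n : ℕ} (M : Mat n) : hermAdj (hermAdj M) = M := by
  simp only [hermAdj, Matrix.conjTranspose_mul, hermGram_conjTranspose,
    Matrix.conjTranspose_conjTranspose]
  calc hermGram n * (hermGram n * (M * hermGram n)) * hermGram n
      = (hermGram n * hermGram n) * M * (hermGram n * hermGram n) := by simp only [mul_assoc]
    _ = M := by rw [hermGram_mul_hermGram, one_mul, mul_one]

lemma hermAdj_zero {n : ℕ} : hermAdj (0 : Mat n) = 0 := by simp [hermAdj]

lemma hermAdj_smul {n : ℕ} (c : ℂ) (M : Mat n) : hermAdj (c • M) = star c • hermAdj M := by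
  simp [hermAdj, Matrix.conjTranspose_smul]

lemma continuous_hermAdj {n : ℕ} : Continuous (hermAdj : Mat n → Mat n) := by
  exact (continuous_const.matrix_mul continuous_id.matrix_conjTranspose).matrix_mul continuous_const

lemma herm_mulVec_right {n : ℕ} (M : Mat n) (u v : Vec n) :
    herm n u (M *ᵥ v) = herm n (hermAdj M *ᵥ u) v := by
  rw [herm_eq_dotProduct, herm_eq_dotProduct, hermAdj, Matrix.mulVec_mulVec, ← mul_assoc,
    ← mul_assoc, hermGram_mul_hermGram, one_mul, ← Matrix.mulVec_mulVec, Matrix.star_mulVec,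
    dotProduct_comm, ← Matrix.dotProduct_mulVec, dotProduct_comm]

open scoped ComplexOrder in
lemma eq_zero_of_herm_eq_zero {n : ℕ} {u : Vec n} (h : ∀ v, herm n u v = 0) : u = 0 := by
  have h1 := h (hermGram n *ᵥ u)
  rw [herm_eq_dotProduct, dotProduct_comm, dotProduct_star_self_eq_zero] at h1
  rw [← Matrix.one_mulVec u, ← hermGram_mul_hermGram, ← Matrix.mulVec_mulVec, h1,
    Matrix.mulVec_zero]

lemma herm_sub_left {n : ℕ} (u v w : Vec n) : herm n (u - v) w = herm n u w - herm n v w := by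
  simp [herm_eq_dotProduct, Matrix.mulVec_sub]

lemma herm_smul_right {n : ℕ} (c : ℂ) (u v : Vec n) : herm n u (c • v) = star c * herm n u v := by
  simp [herm_eq_dotProduct]

lemma continuous_herm_right {n : ℕ} (u : Vec n) : Continuous fun v => herm n u v := by
  unfold herm
  fun_prop

lemma herm_single_zero {n : ℕ} (u : Vec n) : herm n u (Pi.single 0 1) = -u 0 := by
  simp [herm]

lemma eq_zero_of_herm_self {n : ℕ} {u : Vec n} (h : herm n u u = 0) (h0 : u 0 = 0) : u = 0 := by
  rw [herm, h0] at h
  simp only [zero_mul, neg_zero, zero_add, Complex.mul_conj] at h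
  have h1 : ∑ j : Fin n, Complex.normSq (u j.succ) = 0 := by exact_mod_cast h
  rw [Finset.sum_eq_zero_iff_of_nonneg fun j _ => Complex.normSq_nonneg _] at h1
  ext i
  refine Fin.cases h0 (fun j => ?_) i
  simpa using h1 j (Finset.mem_univ j)

lemma hermAdj_mul_self_of_mem {n : ℕ} {A : GLn n} (hA : A ∈ unitaryGL n) :
    hermAdj (A : Mat n) * (A : Mat n) = 1 := by
  refine Matrix.ext_of_mulVec_single fun i => ?_
  rw [← sub_eq_zero]
  refine eq_zero_of_herm_eq_zero fun v => ?_
  rw [herm_sub_left, ← Matrix.mulVec_mulVec, ← herm_mulVec_right, hA, Matrix.one_mulVec, sub_self]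

lemma val_inv_of_mem {n : ℕ} {A : GLn n} (hA : A ∈ unitaryGL n) :
    ((A⁻¹ : GLn n) : Mat n) = hermAdj (A : Mat n) :=
  (Units.inv_eq_of_mul_eq_one_left (hermAdj_mul_self_of_mem hA))

lemma mul_hermAdj_self_of_mem {n : ℕ} {A : GLn n} (hA : A ∈ unitaryGL n) :
    (A : Mat n) * hermAdj (A : Mat n) = 1 := by
  rw [← val_inv_of_mem hA, Units.mul_inv]

lemma hermAdj_mulVec_eq_zero {n : ℕ} {B : Mat n} (hB : B * hermAdj B = 0) {z : Vec n}
    (hz : herm n z (B *ᵥ Pi.single 0 1) = 0) : hermAdj B *ᵥ z = 0 := by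
  refine eq_zero_of_herm_self ?_ ?_
  · rw [herm_mulVec_right, hermAdj_hermAdj, Matrix.mulVec_mulVec, hB, Matrix.zero_mulVec]
    simp [herm]
  · rw [herm_mulVec_right, herm_single_zero] at hz
    exact neg_eq_zero.1 hz

lemma mulVec_single_zero_ne_zero {n : ℕ} {B : Mat n} (hB : B * hermAdj B = 0) (hB0 : B ≠ 0) :
    B *ᵥ Pi.single 0 1 ≠ 0 := by
  intro h
  apply hB0
  have : hermAdj B = 0 := Matrix.ext_of_mulVec_single fun i => by
    rw [hermAdj_mulVec_eq_zero hB (by rw [h]; simp [herm]), Matrix.zero_mulVec]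
  rw [← hermAdj_hermAdj B, this, hermAdj_zero]

lemma basePt_eq_linePt (n : ℕ) : basePt n = linePt (Pi.single 0 1) := by
  have h : (Pi.single 0 1 : Vec n) ≠ 0 := by simp
  rw [linePt_of_ne_zero h, basePt]

lemma mem_tangentAt_linePt {n : ℕ} {q : Pn n} {v : Vec n} (hv : v ≠ 0) :
    q ∈ tangentAt (linePt v) ↔ herm n q.rep v = 0 := by
  obtain ⟨c, hc, hvc⟩ := exists_rep_linePt hv
  simp [tangentAt, hvc, herm_smul_right, hc]

end HermitianForm

section Dynamics

attribute [local instance] Matrix.normedAddCommGroup Matrix.normedSpace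

/-- A matrix rescaled to have norm one. -/
noncomputable def unitMat {n : ℕ} (A : Mat n) : Mat n := ((‖A‖⁻¹ : ℝ) : ℂ) • A

lemma norm_unitMat {n : ℕ} {A : Mat n} (hA : A ≠ 0) : ‖unitMat A‖ = 1 := by
  rw [unitMat, norm_smul, Complex.norm_real, norm_inv, norm_norm,
    inv_mul_cancel₀ (norm_ne_zero_iff.2 hA)]

lemma GLn_val_ne_zero {n : ℕ} (A : GLn n) : (A : Mat n) ≠ 0 := A.ne_zero

lemma matAct_unitMat {n : ℕ} {A : Mat n} (hA : A ≠ 0) : matAct (unitMat A) = matAct A :=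
  matAct_smul (by simpa using hA) A

lemma matAct_hermAdj_unitMat {n : ℕ} {A : Mat n} (hA : A ≠ 0) :
    matAct (hermAdj (unitMat A)) = matAct (hermAdj A) := by
  rw [unitMat, hermAdj_smul]
  exact matAct_smul (by simpa using hA) _

lemma mul_hermAdj_eq_zero_of_tendsto {n : ℕ} {ι : Type*} {l : Filter ι} [l.NeBot] {A : ι → GLn n}
    (hA : ∀ i, A i ∈ unitaryGL n) (hl : Tendsto (fun i => ‖(A i : Mat n)‖) l atTop) {B : Mat n}
    (hB : Tendsto (fun i => unitMat (A i : Mat n)) l (𝓝 B)) :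
    B * hermAdj B = 0 ∧ hermAdj B * B = 0 := by
  have hadj : Tendsto (fun i => hermAdj (unitMat (A i : Mat n))) l (𝓝 (hermAdj B)) :=
    (continuous_hermAdj.tendsto B).comp hB
  have hscal : Tendsto (fun i => ((‖(A i : Mat n)‖⁻¹ : ℝ) : ℂ)) l (𝓝 0) := by
    have := (Complex.continuous_ofReal.tendsto 0).comp hl.inv_tendsto_atTop
    simpa [Function.comp_def] using this
  have hzero : Tendsto (fun i => ((‖(A i : Mat n)‖⁻¹ : ℝ) : ℂ) •
      ((‖(A i : Mat n)‖⁻¹ : ℝ) : ℂ) • (1 : Mat n)) l (𝓝 0) := by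
    simpa using hscal.smul (hscal.smul_const (1 : Mat n))
  constructor
  · refine tendsto_nhds_unique (hB.mul hadj) (hzero.congr fun i => ?_)
    rw [unitMat, hermAdj_smul, smul_mul_smul_comm, mul_hermAdj_self_of_mem (hA i), smul_smul]
    simp
  · refine tendsto_nhds_unique (hadj.mul hB) (hzero.congr fun i => ?_)
    rw [unitMat, hermAdj_smul, smul_mul_smul_comm, hermAdj_mul_self_of_mem (hA i), smul_smul]
    simp

lemma isCompact_image_unitary {n : ℕ} (R : ℝ) :
    IsCompact ((QuotientGroup.mk : GLn n → PGLn n) ''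
      {A | A ∈ unitaryGL n ∧ ‖(A : Mat n)‖ ≤ R}) := by
  let S : Set (Mat n) := {M | (M * hermAdj M = 1 ∧ hermAdj M * M = 1) ∧ ‖M‖ ≤ R}
  have hS : IsCompact S := by
    have : ProperSpace (Mat n) := FiniteDimensional.proper ℂ _
    refine Metric.isCompact_of_isClosed_isBounded ?_ ?_
    · refine IsClosed.inter (IsClosed.inter ?_ ?_) ?_
      · exact isClosed_eq (continuous_id.matrix_mul continuous_hermAdj) continuous_const
      · exact isClosed_eq (continuous_hermAdj.matrix_mul continuous_id) continuous_const
      · exact isClosed_le continuous_norm continuous_const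
    · exact (Metric.isBounded_closedBall (x := (0 : Mat n)) (r := R)).subset fun M hM => by
        simpa using hM.2
  let u : S → GLn n := fun M => ⟨M, hermAdj M, M.2.1.1, M.2.1.2⟩
  have hu : Continuous u := by
    rw [Units.continuous_iff]
    exact ⟨continuous_subtype_val, continuous_hermAdj.comp continuous_subtype_val⟩
  have : CompactSpace S := isCompact_iff_compactSpace.1 hS
  have himg : {A : GLn n | A ∈ unitaryGL n ∧ ‖(A : Mat n)‖ ≤ R} ⊆ Set.range u := fun A hA =>
    ⟨⟨A, ⟨mul_hermAdj_self_of_mem hA.1, hermAdj_mul_self_of_mem hA.1⟩, hA.2⟩, Units.ext rfl⟩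
  have himg' : Set.range u ⊆ {A : GLn n | A ∈ unitaryGL n ∧ ‖(A : Mat n)‖ ≤ R} := by
    rintro _ ⟨M, rfl⟩
    refine ⟨fun x y => ?_, M.2.2⟩
    change herm n ((M : Mat n) *ᵥ x) ((M : Mat n) *ᵥ y) = _
    rw [herm_mulVec_right, Matrix.mulVec_mulVec, M.2.1.2, Matrix.one_mulVec]
  rw [himg.antisymm himg']
  exact (isCompact_range hu).image QuotientGroup.continuous_mk

lemma t2Space_PGLn (n : ℕ) : T2Space (PGLn n) := by
  have : IsClosed (Subgroup.center (GLn n) : Set (GLn n)) := by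
    rw [Subgroup.coe_center, ← Set.centralizer_univ]
    exact Set.isClosed_centralizer _
  infer_instance

lemma tendsto_norm_lift {n : ℕ} {G : Subgroup (PGLn n)} (hdisc : DiscreteTopology G)
    {A : G → GLn n} (hA : ∀ g, A g ∈ unitaryGL n) (hmk : ∀ g, (A g : PGLn n) = g) :
    Tendsto (fun g => ‖(A g : Mat n)‖) cofinite atTop := by
  have := t2Space_PGLn n
  have hG := G.tendsto_coe_cofinite_of_discrete (isDiscrete_iff_discreteTopology.2 hdisc)
  refine tendsto_atTop.2 fun R => ?_
  have h := hG (isCompact_image_unitary (n := n) R).compl_mem_cocompact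
  filter_upwards [h] with g hg
  by_contra hlt
  exact hg ⟨A g, ⟨hA g, (not_le.1 hlt).le⟩, hmk g⟩

lemma exists_seq_of_mapClusterPt {n : ℕ} {G : Subgroup (PGLn n)} {A : G → GLn n}
    (hprop : Tendsto (fun g => ‖(A g : Mat n)‖) cofinite atTop) {B : Mat n}
    (hB : MapClusterPt B cofinite fun g => unitMat (A g : Mat n)) :
    ∃ g : ℕ → G, Function.Injective g ∧ Tendsto (fun m => ‖(A (g m) : Mat n)‖) atTop atTop ∧
      Tendsto (fun m => unitMat (A (g m) : Mat n)) atTop (𝓝 B) := by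
  obtain ⟨u, hu, huB⟩ := mapClusterPt_iff_ultrafilter.1 hB
  let L : Filter G := comap (fun g => ‖(A g : Mat n)‖) atTop ⊓
    comap (fun g => unitMat (A g : Mat n)) (𝓝 B)
  have huL : (u : Filter G) ≤ L :=
    le_inf ((hprop.mono_left hu).le_comap) huB.le_comap
  have : FirstCountableTopology (Mat n) :=
    inferInstanceAs (FirstCountableTopology (Fin (n + 1) → Fin (n + 1) → ℂ))
  have : L.IsCountablyGenerated := Filter.Inf.isCountablyGenerated _ _
  have : L.NeBot := u.neBot.mono huL
  obtain ⟨g, hg⟩ := exists_seq_tendsto L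
  have hg1 : Tendsto (fun m => ‖(A (g m) : Mat n)‖) atTop atTop :=
    (tendsto_comap (f := fun g => ‖(A g : Mat n)‖)).comp (hg.mono_right inf_le_left)
  have hg2 : Tendsto (fun m => unitMat (A (g m) : Mat n)) atTop (𝓝 B) :=
    (tendsto_comap (f := fun g => unitMat (A g : Mat n))).comp (hg.mono_right inf_le_right)
  obtain ⟨φ, hφ, hmono⟩ := strictMono_subseq_of_tendsto_atTop hg1
  refine ⟨g ∘ φ, fun a b hab => hmono.injective ?_, hg1.comp hφ.tendsto_atTop,
    hg2.comp hφ.tendsto_atTop⟩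
  exact congrArg (fun g => ‖(A g : Mat n)‖) hab

lemma isCompact_setOf_mapClusterPt_unitMat {n : ℕ} {ι : Type*} (A : ι → GLn n) (l : Filter ι) :
    IsCompact {B : Mat n | MapClusterPt B l fun i => unitMat (A i : Mat n)} := by
  have : ProperSpace (Mat n) := FiniteDimensional.proper ℂ _
  refine (isCompact_sphere (0 : Mat n) 1).of_isClosed_subset isClosed_setOfPred_clusterPt ?_
  intro B hB
  have hclosed : IsClosed (Metric.sphere (0 : Mat n) 1) := Metric.isClosed_sphere
  refine hclosed.mem_of_mapClusterPt hB (Eventually.of_forall fun i => ?_)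
  simpa using norm_unitMat (GLn_val_ne_zero (A i))

lemma exists_subseq_tendsto_unitMat {n : ℕ} (A : ℕ → GLn n) :
    ∃ B : Mat n, B ≠ 0 ∧ ∃ φ : ℕ → ℕ, StrictMono φ ∧
      Tendsto (fun m => unitMat (A (φ m) : Mat n)) atTop (𝓝 B) := by
  have : ProperSpace (Mat n) := FiniteDimensional.proper ℂ _
  obtain ⟨B, hB, φ, hφ, hlim⟩ := (isCompact_sphere (0 : Mat n) 1).tendsto_subseq
    (x := fun m => unitMat (A m : Mat n)) fun m => by
      simpa using norm_unitMat (GLn_val_ne_zero (A m))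
  refine ⟨B, ?_, φ, hφ, hlim⟩
  rintro rfl
  simp at hB

lemma not_unifConvOnCompacts_of_mulVec_eq_zero {n : ℕ} {M : ℕ → Mat n} {C : Mat n}
    (hinj : ∀ m v, v ≠ 0 → M m *ᵥ v ≠ 0) (hM : Tendsto M atTop (𝓝 C)) (hC : C ≠ 0)
    {U : Set (Pn n)} (hU : IsOpen U) {z : Pn n} (hzU : z ∈ U) (hz : C *ᵥ z.rep = 0)
    (F : Pn n → Pn n) : ¬ UnifConvOnCompacts (fun m => matAct (M m)) F U := by
  intro hunif
  obtain ⟨x, hx⟩ : ∃ x, C *ᵥ x ≠ 0 := by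
    by_contra! h
    exact hC (Matrix.ext_of_mulVec_single fun i => by rw [h, Matrix.zero_mulVec])
  obtain ⟨i, hi⟩ : ∃ i, (C *ᵥ x) i ≠ 0 := by
    by_contra! h
    exact hx (funext h)
  let θ : Vec n → ℝ := fun v => ‖v i‖ / ‖v‖
  have hθc : ∀ v, v ≠ 0 → ContinuousAt θ v := fun v hv =>
    ContinuousAt.div (continuous_apply i).norm.continuousAt (by fun_prop) (norm_ne_zero_iff.2 hv)
  have hθs : ∀ c : ℂ, c ≠ 0 → ∀ v, θ (c • v) = θ v := fun c hc v => by
    simp only [θ, Pi.smul_apply, norm_smul]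
    exact mul_div_mul_left _ _ (norm_ne_zero_iff.2 hc)
  have hθpt : ∀ v, v ≠ 0 → θ (linePt v).rep = θ v := fun v hv => by
    obtain ⟨c, hc, hvc⟩ := exists_rep_linePt hv
    rw [hvc, hθs c hc]
  have hθP : Continuous fun p : Pn n => θ p.rep := continuous_of_homogeneous hθc hθs
  have hδ : 0 < θ (C *ᵥ x) := div_pos (norm_pos_iff.2 hi) (norm_pos_iff.2 hx)
  set δ := θ (C *ᵥ x)
  let y : ℂ → Vec n := fun t => z.rep + t • x
  have hyc : Continuous y := by fun_prop
  have hCy : ∀ t, C *ᵥ y t = t • (C *ᵥ x) := fun t => by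
    simp only [y, Matrix.mulVec_add, Matrix.mulVec_smul, hz, zero_add]
  have hy0 : ∀ t, y t ≠ 0 := fun t ht => by
    have h1 := hCy t
    rw [ht, Matrix.mulVec_zero] at h1
    have ht0 : t = 0 := (smul_eq_zero.1 h1.symm).resolve_right hx
    simp only [y, ht0, zero_smul, add_zero] at ht
    exact z.rep_nonzero ht
  let p : ℂ → Pn n := fun t => linePt (y t)
  have hpc : Continuous p := continuous_iff_continuousAt.2 fun t =>
    ContinuousAt.comp (f := y) (continuousAt_linePt (hy0 t)) hyc.continuousAt
  have hp0 : p 0 = z := by simp only [p, y, zero_smul, add_zero, linePt_rep]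
  obtain ⟨ε, hε, hball⟩ := Metric.nhds_basis_closedBall.mem_iff.1
    (hpc.continuousAt.preimage_mem_nhds (hU.mem_nhds (hp0.symm ▸ hzU : p 0 ∈ U)))
  have hK : IsCompact (p '' Metric.closedBall 0 ε) := (isCompact_closedBall 0 ε).image hpc
  have hunifK := hunif _ (Set.image_subset_iff.2 hball) hK
    {q | |θ q.1.rep - θ q.2.rep| < δ / 4}
    (isOpen_lt ((hθP.comp continuous_fst).sub (hθP.comp continuous_snd)).abs continuous_const)
    (fun q => by simpa using hδ)
  have hmat : ∀ m t, θ (matAct (M m) (p t)).rep = θ (M m *ᵥ y t) := fun m t => by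
    rw [matAct_linePt _ (hy0 t), hθpt _ (hinj m _ (hy0 t))]
  have hmulVec : ∀ v, Tendsto (fun m => M m *ᵥ v) atTop (𝓝 (C *ᵥ v)) := fun v =>
    ((continuous_id.matrix_mulVec continuous_const).tendsto C).comp hM
  have hF : ∀ t, t ≠ 0 → t ∈ Metric.closedBall (0 : ℂ) ε → 3 * δ / 4 ≤ θ (F (p t)).rep := by
    intro t ht htε
    have hlim : Tendsto (fun m => θ (M m *ᵥ y t)) atTop (𝓝 δ) := by
      have h1 := (hθc (C *ᵥ y t) (by rw [hCy]; exact smul_ne_zero ht hx)).tendsto.comp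
        (hmulVec (y t))
      rwa [hCy, hθs t ht] at h1
    have hbound : ∀ᶠ m in atTop, θ (M m *ᵥ y t) ≤ θ (F (p t)).rep + δ / 4 := by
      filter_upwards [hunifK] with m hm
      have h1 : |θ (F (p t)).rep - θ (matAct (M m) (p t)).rep| < δ / 4 :=
        hm _ (Set.mem_image_of_mem p htε)
      rw [hmat, abs_lt] at h1
      linarith [h1.1]
    have := le_of_tendsto hlim hbound
    linarith
  let r : ℕ → ℂ := fun m => -(M m *ᵥ z.rep) i / (M m *ᵥ x) i
  have hcoord : ∀ v, Tendsto (fun m => (M m *ᵥ v) i) atTop (𝓝 ((C *ᵥ v) i)) := fun v =>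
    ((continuous_apply i).tendsto _).comp (hmulVec v)
  have hr : Tendsto r atTop (𝓝 0) := by
    have h1 := (hcoord z.rep).neg.div (hcoord x) hi
    rw [hz, Pi.zero_apply, neg_zero, zero_div] at h1
    exact h1
  have hxi : ∀ᶠ m in atTop, (M m *ᵥ x) i ≠ 0 := (hcoord x).eventually_ne hi
  obtain ⟨m, hm, hrm, hxm⟩ :=
    (hunifK.and ((hr.eventually (Metric.closedBall_mem_nhds 0 hε)).and hxi)).exists
  have hcont : Continuous fun t => θ (M m *ᵥ y t) := continuous_iff_continuousAt.2 fun t =>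
    ContinuousAt.comp (f := fun t => M m *ᵥ y t) (hθc _ (hinj m _ (hy0 t)))
      (continuous_const.matrix_mulVec hyc).continuousAt
  have hlow : ∀ t, t ≠ 0 → t ∈ Metric.closedBall (0 : ℂ) ε → δ / 2 ≤ θ (M m *ᵥ y t) := by
    intro t ht htε
    have h1 : |θ (F (p t)).rep - θ (matAct (M m) (p t)).rep| < δ / 4 :=
      hm _ (Set.mem_image_of_mem p htε)
    rw [hmat, abs_lt] at h1
    linarith [h1.2, hF t ht htε]
  have hlow0 : δ / 2 ≤ θ (M m *ᵥ y 0) := by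
    refine ge_of_tendsto (x := 𝓝[≠] (0 : ℂ)) (hcont.continuousAt.tendsto.mono_left
      nhdsWithin_le_nhds) ?_
    filter_upwards [self_mem_nhdsWithin,
      nhdsWithin_le_nhds (Metric.closedBall_mem_nhds 0 hε)] with t ht htε
    exact hlow t ht htε
  have hzero : θ (M m *ᵥ y (r m)) = 0 := by
    have : (M m *ᵥ y (r m)) i = 0 := by
      simp only [y, r, Matrix.mulVec_add, Matrix.mulVec_smul, Pi.add_apply, Pi.smul_apply,
        smul_eq_mul]
      field_simp
      ring
    simp [θ, this]
  by_cases hrm0 : r m = 0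
  · rw [hrm0] at hzero
    linarith
  · have := hlow _ hrm0 hrm
    linarith

lemma act_eq_matAct_unitMat {n : ℕ} {G : Subgroup (PGLn n)} {A : G → GLn n}
    (hmk : ∀ g, (A g : PGLn n) = g)
    (g : G) : act (g : PGLn n) = matAct (unitMat (A g : Mat n)) := by
  rw [matAct_unitMat (GLn_val_ne_zero _), ← act_mk, hmk]

lemma act_inv_eq_matAct {n : ℕ} {G : Subgroup (PGLn n)} {A : G → GLn n}
    (hA : ∀ g, A g ∈ unitaryGL n) (hmk : ∀ g, (A g : PGLn n) = g)
    (g : G) :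
    act ((g⁻¹ : G) : PGLn n) = matAct (hermAdj (unitMat (A g : Mat n))) := by
  rw [matAct_hermAdj_unitMat (GLn_val_ne_zero _), ← val_inv_of_mem (hA g), ← act_mk,
    QuotientGroup.mk_inv, hmk, Subgroup.coe_inv]

lemma exists_mem_LambdaCG_of_mulVec_eq_zero {n : ℕ} {G : Subgroup (PGLn n)} {A : G → GLn n}
    (hA : ∀ g, A g ∈ unitaryGL n) (hmk : ∀ g, (A g : PGLn n) = g)
    (hprop : Tendsto (fun g => ‖(A g : Mat n)‖) cofinite atTop)
    {B : Mat n}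
    (hB : MapClusterPt B cofinite fun g => unitMat (A g : Mat n)) {z : Pn n}
    (hz : B *ᵥ z.rep = 0) : ∃ p ∈ LambdaCG G, z ∈ tangentAt p := by
  obtain ⟨g, hg, hg1, hg2⟩ := exists_seq_of_mapClusterPt hprop hB
  obtain ⟨-, hB2⟩ := mul_hermAdj_eq_zero_of_tendsto (fun m => hA (g m)) hg1 hg2
  have hB0 : B ≠ 0 := by
    rintro rfl
    have h1 : Tendsto (fun m => ‖unitMat (A (g m) : Mat n)‖) atTop (𝓝 ‖(0 : Mat n)‖) := hg2.norm
    simp only [norm_unitMat (GLn_val_ne_zero _), norm_zero] at h1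
    exact one_ne_zero (tendsto_nhds_unique tendsto_const_nhds h1)
  have hadj0 : hermAdj B ≠ 0 := fun h => hB0 (by rw [← hermAdj_hermAdj B, h, hermAdj_zero])
  have he : (Pi.single 0 1 : Vec n) ≠ 0 := by simp
  have hne : hermAdj B *ᵥ Pi.single 0 1 ≠ 0 :=
    mulVec_single_zero_ne_zero (by rwa [hermAdj_hermAdj]) hadj0
  refine ⟨linePt (hermAdj B *ᵥ Pi.single 0 1), ⟨fun m => (g m)⁻¹, inv_injective.comp hg, ?_⟩, ?_⟩
  · simp only [act_inv_eq_matAct hA hmk, basePt_eq_linePt, matAct_linePt _ he]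
    exact (continuousAt_linePt hne).tendsto.comp
      (((continuous_hermAdj.matrix_mulVec continuous_const).tendsto B).comp hg2)
  · rw [mem_tangentAt_linePt hne, herm_mulVec_right, hermAdj_hermAdj, hz]
    simp [herm]

lemma mem_eqRegion_of_forall_mulVec_ne_zero {n : ℕ} {G : Subgroup (PGLn n)} {A : G → GLn n}
    (hmk : ∀ g, (A g : PGLn n) = g)
    {z : Pn n}
    (hz : ∀ B, MapClusterPt B cofinite (fun g => unitMat (A g : Mat n)) → B *ᵥ z.rep ≠ 0) :
    z ∈ eqRegion G := by
  refine ⟨_, isOpen_setOf_forall_mulVec_rep_ne_zero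
    (isCompact_setOf_mapClusterPt_unitMat A cofinite), hz, fun g => ?_⟩
  by_cases hconst : ∃ c, ∃ᶠ m in atTop, g m = c
  · obtain ⟨c, hc⟩ := hconst
    obtain ⟨φ, hφ, hgφ⟩ := extraction_of_frequently_atTop hc
    refine ⟨φ, hφ, act (c : PGLn n), fun K _ _ W _ hdiag => Eventually.of_forall fun m x _ => ?_⟩
    simpa only [hgφ m] using hdiag _
  · push Not at hconst
    have hg : Tendsto g atTop cofinite :=
      le_cofinite_iff_eventually_ne.2 fun c => by simpa using hconst c
    obtain ⟨B, -, φ, hφ, hlim⟩ := exists_subseq_tendsto_unitMat (fun m => A (g m))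
    have hBc : MapClusterPt B cofinite fun g => unitMat (A g : Mat n) :=
      MapClusterPt.of_comp (hg.comp hφ.tendsto_atTop) hlim.mapClusterPt
    refine ⟨φ, hφ, matAct B, fun K hKU hK W hW hdiag => ?_⟩
    have h1 := hlim.eventually
      (eventually_matAct_near hK (fun q hq => hKU hq B hBc) hW hdiag)
    simpa only [act_eq_matAct_unitMat hmk] using h1

lemma notMem_eqRegion_of_mem_tangentAt {n : ℕ} {G : Subgroup (PGLn n)} {A : G → GLn n}
    (hA : ∀ g, A g ∈ unitaryGL n) (hmk : ∀ g, (A g : PGLn n) = g)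
    (hprop : Tendsto (fun g => ‖(A g : Mat n)‖) cofinite atTop)
    {p z : Pn n} (hp : p ∈ LambdaCG G) (hz : z ∈ tangentAt p) :
    z ∉ eqRegion G := by
  rintro ⟨U, hU, hzU, hseq⟩
  obtain ⟨g, hg, hgp⟩ := hp
  obtain ⟨B, hB0, φ, hφ, hlim⟩ := exists_subseq_tendsto_unitMat (fun m => A (g m))
  have hgφ : Tendsto (fun m => ‖(A (g (φ m)) : Mat n)‖) atTop atTop :=
    hprop.comp ((Nat.cofinite_eq_atTop ▸ hg.tendsto_cofinite).comp hφ.tendsto_atTop)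
  obtain ⟨hB1, -⟩ := mul_hermAdj_eq_zero_of_tendsto (fun m => hA (g (φ m))) hgφ hlim
  have he : (Pi.single 0 1 : Vec n) ≠ 0 := by simp
  have hne := mulVec_single_zero_ne_zero hB1 hB0
  let η : Vec n → ℝ := fun v => ‖herm n z.rep v‖ / ‖v‖
  have hηc : ∀ v, v ≠ 0 → ContinuousAt η v := fun v hv =>
    ContinuousAt.div (continuous_herm_right _).norm.continuousAt (by fun_prop)
      (norm_ne_zero_iff.2 hv)
  have hηs : ∀ c : ℂ, c ≠ 0 → ∀ v, η (c • v) = η v := fun c hc v => by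
    simp only [η, herm_smul_right, norm_mul, norm_smul, norm_star]
    exact mul_div_mul_left _ _ (norm_ne_zero_iff.2 hc)
  have hη0 : η (B *ᵥ Pi.single 0 1) = 0 := by
    have h1 : Tendsto (fun m => linePt (unitMat (A (g (φ m)) : Mat n) *ᵥ Pi.single 0 1)) atTop
        (𝓝 p) := by
      have := hgp.comp hφ.tendsto_atTop
      simpa only [Function.comp_def, act_eq_matAct_unitMat hmk, basePt_eq_linePt,
        matAct_linePt _ he] using this
    have h2 : Tendsto (fun m => unitMat (A (g (φ m)) : Mat n) *ᵥ Pi.single 0 1) atTop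
        (𝓝 (B *ᵥ Pi.single 0 1)) :=
      ((continuous_id.matrix_mulVec continuous_const).tendsto B).comp hlim
    have h3 := ((continuous_of_homogeneous hηc hηs).tendsto p).comp h1
    have hp0 : η p.rep = 0 := by
      have : herm n z.rep p.rep = 0 := hz
      simp [η, this]
    rw [hp0] at h3
    refine tendsto_nhds_unique ((hηc _ hne).tendsto.comp h2) (h3.congr' ?_)
    filter_upwards [h2.eventually_ne hne] with m hm
    obtain ⟨c, hc, hvc⟩ := exists_rep_linePt hm
    simp only [Function.comp_apply]
    rw [hvc, hηs c hc]
  have hherm : herm n z.rep (B *ᵥ Pi.single 0 1) = 0 := by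
    exact norm_eq_zero.1 ((div_eq_zero_iff.1 hη0).resolve_right (norm_ne_zero_iff.2 hne))
  obtain ⟨ψ, hψ, F, hF⟩ := hseq fun m => (g (φ m))⁻¹
  simp only [act_inv_eq_matAct hA hmk] at hF
  refine not_unifConvOnCompacts_of_mulVec_eq_zero (C := hermAdj B) ?_
    (((continuous_hermAdj.tendsto B).comp hlim).comp hψ.tendsto_atTop)
    (fun h => hB0 (by rw [← hermAdj_hermAdj B, h, hermAdj_zero])) hU hzU
    (hermAdj_mulVec_eq_zero hB1 hherm) F hF
  intro m v hv h0
  have hA0 := GLn_val_ne_zero (A (g (φ (ψ m))))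
  simp only [Function.comp_apply, unitMat, hermAdj_smul, Matrix.smul_mulVec, smul_eq_zero] at h0
  rcases h0 with h0 | h0
  · simp [hA0] at h0
  · apply hv
    rw [← Matrix.one_mulVec v, ← mul_hermAdj_self_of_mem (hA (g (φ (ψ m)))),
      ← Matrix.mulVec_mulVec, h0, Matrix.mulVec_zero]

end Dynamics

/-- For an infinite discrete subgroup `G` of `PU(1,n)`, the complement of
the equicontinuity region of `G` in `ℙⁿ_ℂ` is the union of all complex projective
hyperplanes tangent to `∂𝐇ⁿ_ℂ` at points of the Chen–Greenberg limit set of `G`. -/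
theorem eqRegion_compl_eq_union_tangent_hyperplanes
    (n : ℕ) (hn : 1 ≤ n) (G : Subgroup (PGLn n))
    (hPU : (G : Set (PGLn n)) ⊆ PUset n) (hdisc : DiscreteTopology ↥G)
    (hinf : (G : Set (PGLn n)).Infinite) :
    (eqRegion G)ᶜ = ⋃ p ∈ LambdaCG G, tangentAt p := by
  choose A hA hmk using fun g : G => hPU g.2
  have hprop := tendsto_norm_lift hdisc hA hmk
  ext z
  simp only [Set.mem_compl_iff, Set.mem_iUnion, exists_prop]
  constructor
  · intro hz
    by_contra hcon
    refine hz (mem_eqRegion_of_forall_mulVec_ne_zero hmk fun B hB hBz => hcon ?_)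
    exact exists_mem_LambdaCG_of_mulVec_eq_zero hA hmk hprop hB hBz
  · rintro ⟨p, hp, hz⟩
    exact notMem_eqRegion_of_mem_tangentAt hA hmk hprop hp hz
end

section
/- Let n ≥ 1 and let G be a discrete subgroup of PU(1,n). Then G is finite if and only if every element of G has finite order. -/
open Filter Topology Matrix

theorem Int.isJacobsonRing : IsJacobsonRing ℤ := by
  rw [isJacobsonRing_iff_prime_eq]
  intro P hP
  by_cases h : P = ⊥
  · subst h
    rw [eq_bot_iff]
    intro x hx
    rw [Ideal.mem_jacobson_bot] at hx
    have h1 := Int.isUnit_iff.1 (hx 3)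
    rw [Ideal.mem_bot]
    omega
  · have := hP.isMaximal h
    exact Ideal.jacobson_eq_self_of_isMaximal

theorem Field.finite_of_finiteType_int (S : Type*) [Field S] [Algebra.FiniteType ℤ S] :
    Finite S := by
  have := Int.isJacobsonRing
  have hfin : Module.Finite ℤ S := finite_of_finite_type_of_isJacobsonRing ℤ S
  obtain ⟨p, hp⟩ := CharP.exists S
  have hp0 : p ≠ 0 := by
    rintro rfl
    have := CharP.charP_to_charZero S
    have hinj : Function.Injective (algebraMap ℤ S) := (algebraMap ℤ S).injective_int
    have := Algebra.IsIntegral.of_finite ℤ S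
    exact Int.not_isField (isField_of_isIntegral_of_isField hinj (Field.toIsField S))
  refine Module.finite_of_fg_torsion S fun x => ⟨⟨(p : ℤ), ?_⟩, ?_⟩
  · exact mem_nonZeroDivisors_of_ne_zero (by exact_mod_cast hp0)
  · change (p : ℤ) • x = 0
    simp

theorem Ideal.finite_quotient_of_finiteType_int {R : Type*} [CommRing R] [Algebra.FiniteType ℤ R]
    (I : Ideal R) [I.IsMaximal] : Finite (R ⧸ I) := by
  have h : Algebra.FiniteType ℤ (R ⧸ I) :=
    Algebra.FiniteType.of_surjective (Ideal.Quotient.mkₐ ℤ I) Ideal.Quotient.mk_surjective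
  let _ := Ideal.Quotient.field I
  exact @Field.finite_of_finiteType_int (R ⧸ I) _ (by convert! h)

theorem exists_isMaximal_notMem {R : Type*} [CommRing R] [IsDomain R] [Algebra.FiniteType ℤ R]
    {a : R} (ha : a ≠ 0) : ∃ I : Ideal R, I.IsMaximal ∧ a ∉ I := by
  have := Int.isJacobsonRing
  have : IsJacobsonRing R := isJacobsonRing_of_finiteType (A := ℤ)
  have hb : (⊥ : Ideal R).jacobson = ⊥ :=
    isJacobsonRing_iff_prime_eq.1 this ⊥ Ideal.isPrime_bot
  by_contra! h
  apply ha
  rw [← Ideal.mem_bot, ← hb, Ideal.jacobson, Ideal.mem_sInf]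
  exact fun {I} hI => h I hI.2

section

variable {ι : Type*} [Fintype ι] [DecidableEq ι]

theorem Matrix.SpecialLinearGroup.eq_one_of_pow_eq_one_of_map_eq_one {R S : Type*} [CommRing R]
    [IsDomain R] [Field S] (f : R →+* S) {g : SpecialLinearGroup ι R}
    {k : ℕ} (hk : (k : S) ≠ 0) (hgk : g ^ k = 1) (hg : SpecialLinearGroup.map f g = 1) :
    g = 1 := by
  let A : Matrix ι ι R := g
  have hA : f.mapMatrix A = 1 := by
    have := congrArg (fun x : SpecialLinearGroup ι S => (x : Matrix ι ι S)) hg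
    simpa using this
  have hdet : (∑ i ∈ Finset.range k, A ^ i).det ≠ 0 := by
    intro h0
    have h1 : f.mapMatrix (∑ i ∈ Finset.range k, A ^ i) = (k : Matrix ι ι S) := by
      rw [map_sum]
      simp [-RingHom.mapMatrix_apply, hA]
    have h2 := congrArg f h0
    rw [RingHom.map_det, h1, map_zero, ← Matrix.diagonal_natCast, Matrix.det_diagonal] at h2
    simp [hk] at h2
  have hmul : (A - 1) * (∑ i ∈ Finset.range k, A ^ i) = 0 := by
    rw [mul_geom_sum]
    have := congrArg (fun x : SpecialLinearGroup ι R => (x : Matrix ι ι R)) hgk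
    simp only [SpecialLinearGroup.coe_pow, SpecialLinearGroup.coe_one] at this
    rw [this, sub_self]
  have h3 : A - 1 = 0 := by
    have h4 := congrArg (· * (∑ i ∈ Finset.range k, A ^ i).adjugate) hmul
    simp only [mul_assoc, Matrix.mul_adjugate, Matrix.mul_smul, mul_one, zero_mul] at h4
    exact (smul_eq_zero.1 h4).resolve_left hdet
  exact Subtype.ext (sub_eq_zero.1 h3)

/-- A torsion subgroup of `SL` over a finitely generated domain of characteristic zero embeds in a
product of two groups `SL` over finite fields of different characteristics. -/
theorem Matrix.SpecialLinearGroup.finite_of_torsion_of_finiteType {R : Type*} [CommRing R]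
    [IsDomain R] [CharZero R] [Algebra.FiniteType ℤ R] (T : Subgroup (SpecialLinearGroup ι R))
    (hT : ∀ g ∈ T, IsOfFinOrder g) : Finite T := by
  obtain ⟨I, hI, -⟩ := exists_isMaximal_notMem (one_ne_zero (α := R))
  let _ := Ideal.Quotient.field I
  have := I.finite_quotient_of_finiteType_int
  obtain ⟨p, hp⟩ := CharP.exists (R ⧸ I)
  have hp0 : p ≠ 0 := CharP.char_ne_zero_of_finite (R ⧸ I) p
  have hpp : p.Prime := (CharP.char_is_prime_or_zero (R ⧸ I) p).resolve_right hp0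
  obtain ⟨J, hJ, hpJ⟩ := exists_isMaximal_notMem (R := R) (a := (p : R)) (by exact_mod_cast hp0)
  let _ := Ideal.Quotient.field J
  have := J.finite_quotient_of_finiteType_int
  let φ : T →* SpecialLinearGroup ι (R ⧸ I) × SpecialLinearGroup ι (R ⧸ J) :=
    ((SpecialLinearGroup.map (Ideal.Quotient.mk I)).prod
      (SpecialLinearGroup.map (Ideal.Quotient.mk J))).comp T.subtype
  have hφ : Function.Injective φ := by
    rw [injective_iff_map_eq_one]
    rintro ⟨g, hg⟩ hg1
    have hgI : SpecialLinearGroup.map (Ideal.Quotient.mk I) g = 1 := congrArg Prod.fst hg1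
    have hgJ : SpecialLinearGroup.map (Ideal.Quotient.mk J) g = 1 := congrArg Prod.snd hg1
    rw [Subgroup.mk_eq_one]
    by_contra hne
    have hord : orderOf g ≠ 1 := fun h => hne (orderOf_eq_one_iff.1 h)
    obtain ⟨l, hl, hld⟩ := Nat.exists_prime_and_dvd hord
    have hx : orderOf (g ^ (orderOf g / l)) = l :=
      orderOf_pow_orderOf_div (hT g hg).orderOf_pos.ne' hld
    have hxl : (g ^ (orderOf g / l)) ^ l = 1 := by
      have := pow_orderOf_eq_one (g ^ (orderOf g / l))
      rwa [hx] at this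
    have hx1 : g ^ (orderOf g / l) = 1 := by
      by_cases hlp : l = p
      · refine eq_one_of_pow_eq_one_of_map_eq_one (Ideal.Quotient.mk J) ?_ hxl (by simp [hgJ])
        rw [hlp, ← map_natCast (Ideal.Quotient.mk J)]
        exact fun h => hpJ (Ideal.Quotient.eq_zero_iff_mem.1 h)
      · refine eq_one_of_pow_eq_one_of_map_eq_one (Ideal.Quotient.mk I) ?_ hxl (by simp [hgI])
        rw [Ne, CharP.cast_eq_zero_iff (R ⧸ I) p]
        exact fun h => hlp ((Nat.prime_dvd_prime_iff_eq hpp hl).1 h).symm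
    rw [hx1, orderOf_one] at hx
    exact hl.one_lt.ne hx
  exact Finite.of_injective φ hφ

/-- Schur's theorem on periodic linear groups, for subgroups of `SL`. -/
theorem Matrix.SpecialLinearGroup.finite_closure_of_torsion {K : Type*} [Field K] [CharZero K]
    {s : Set (SpecialLinearGroup ι K)} (hs : s.Finite)
    (hT : ∀ g ∈ Subgroup.closure s, IsOfFinOrder g) : Finite (Subgroup.closure s) := by
  let E : Set K := ⋃ g ∈ s, Set.range fun ij : ι × ι => (g : Matrix ι ι K) ij.1 ij.2
  have hE : E.Finite := hs.biUnion fun g _ => Set.finite_range _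
  let R := Algebra.adjoin ℤ E
  have : Algebra.FiniteType ℤ R := .adjoin_of_finite hE
  let f : R →+* K := R.val.toRingHom
  have hf : Function.Injective f := Subtype.val_injective
  let F : SpecialLinearGroup ι R →* SpecialLinearGroup ι K := SpecialLinearGroup.map f
  have hF : Function.Injective F := by
    intro A B h
    ext i j
    have := congrArg (fun x : SpecialLinearGroup ι K => (x : Matrix ι ι K) i j) h
    exact this
  have hsF : Subgroup.closure s ≤ F.range := by
    rw [Subgroup.closure_le]
    intro g hg
    have hmem : ∀ i j, (g : Matrix ι ι K) i j ∈ R := fun i j =>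
      Algebra.subset_adjoin (Set.mem_biUnion hg ⟨(i, j), rfl⟩)
    let A : Matrix ι ι R := Matrix.of fun i j => ⟨_, hmem i j⟩
    have hA : f.mapMatrix A = g := by ext i j; rfl
    refine ⟨⟨A, hf ?_⟩, Subtype.ext hA⟩
    rw [RingHom.map_det, hA, g.det_coe, map_one]
  have hfin : Finite ((Subgroup.closure s).comap F) :=
    finite_of_torsion_of_finiteType _ fun g hg => (hF.isOfFinOrder_iff).1 (hT _ hg)
  rw [← Subgroup.map_comap_eq_self hsF]
  exact Set.Finite.image F (Set.finite_coe_iff.1 hfin)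

theorem Matrix.norm_trace_le_card_of_pow_eq_one {A : Matrix ι ι ℂ} {k : ℕ} (hk : k ≠ 0)
    (hA : A ^ k = 1) : ‖A.trace‖ ≤ Fintype.card ι := by
  rcases isEmpty_or_nonempty ι with h | h
  · simp
  have hroot : ∀ z ∈ A.charpoly.roots, ‖z‖ = 1 := by
    intro z hz
    have hz' : z ∈ spectrum ℂ A :=
      mem_spectrum_of_isRoot_charpoly (Polynomial.isRoot_of_mem_roots hz)
    have := spectrum.pow_mem_pow A k hz'
    rw [hA, spectrum.one_eq, Set.mem_singleton_iff] at this
    exact Complex.norm_eq_one_of_pow_eq_one this hk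
  rw [trace_eq_sum_roots_charpoly]
  refine (norm_multiset_sum_le _).trans ?_
  rw [Multiset.map_congr rfl hroot, Multiset.map_const', Multiset.sum_replicate, nsmul_one,
    Nat.cast_le, ← A.charpoly_natDegree_eq_dim]
  exact Polynomial.card_roots' _

open scoped MatrixOrder ComplexOrder in
/-- A finite group of matrices is conjugate to a group of unitary matrices. -/
theorem Matrix.SpecialLinearGroup.exists_conjTranspose_conj_eq
    (H : Subgroup (SpecialLinearGroup ι ℂ)) [Finite H] :
    ∃ B C : Matrix ι ι ℂ, B * C = 1 ∧ C * B = 1 ∧ ∀ h ∈ H,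
      (B * (h : Matrix ι ι ℂ) * C)ᴴ =
        B * ((h⁻¹ : SpecialLinearGroup ι ℂ) : Matrix ι ι ℂ) * C := by
  have := Fintype.ofFinite H
  let m : H → Matrix ι ι ℂ := fun h => ((h : SpecialLinearGroup ι ℂ) : Matrix ι ι ℂ)
  let P : Matrix ι ι ℂ := ∑ h : H, (m h)ᴴ * m h
  have hmm : ∀ g h, m (g * h) = m g * m h := fun g h => rfl
  have hm1 : m 1 = 1 := rfl
  have hP : P.PosDef := by
    refine Matrix.posDef_sum ⟨1, Finset.mem_univ _⟩ fun h _ => ?_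
    refine PosDef.conjTranspose_mul_self _ (Matrix.mulVec_injective_of_isUnit ?_)
    rw [isUnit_iff_isUnit_det]
    simp [m]
  obtain ⟨B, hB, hPB⟩ := CStarAlgebra.isStrictlyPositive_iff_eq_star_mul_self.mp
    hP.isStrictlyPositive
  lift B to (Matrix ι ι ℂ)ˣ using hB
  have e1 : (B : Matrix ι ι ℂ) * (↑B⁻¹ : Matrix ι ι ℂ) = 1 := B.mul_inv
  have e2 : (↑B⁻¹ : Matrix ι ι ℂ) * (B : Matrix ι ι ℂ) = 1 := B.inv_mul
  generalize (↑B⁻¹ : Matrix ι ι ℂ) = C at e1 e2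
  generalize (B : Matrix ι ι ℂ) = B at hPB e1 e2
  refine ⟨B, C, e1, e2, fun h hh => ?_⟩
  have hinv : (m ⟨h, hh⟩)ᴴ * P * m ⟨h, hh⟩ = P := by
    simp only [P, Finset.mul_sum, Finset.sum_mul]
    refine Fintype.sum_equiv (Equiv.mulRight ⟨h, hh⟩) _ _ fun g => ?_
    simp [hmm, mul_assoc]
  rw [hPB, star_eq_conjTranspose] at hinv
  have hmi : m ⟨h, hh⟩ * ((h⁻¹ : SpecialLinearGroup ι ℂ) : Matrix ι ι ℂ) = 1 := by
    rw [← SpecialLinearGroup.coe_mul, mul_inv_cancel, SpecialLinearGroup.coe_one]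
  have e3 : Cᴴ * Bᴴ = 1 := by
    rw [← conjTranspose_mul, e1, conjTranspose_one]
  calc (B * m ⟨h, hh⟩ * C)ᴴ
      = Cᴴ * ((m ⟨h, hh⟩)ᴴ * (Bᴴ * B) *
          (m ⟨h, hh⟩ * ((h⁻¹ : SpecialLinearGroup ι ℂ) : Matrix ι ι ℂ))) *
            C := by
        rw [hmi, conjTranspose_mul, conjTranspose_mul]
        simp only [mul_assoc, mul_one, e1]
    _ = Cᴴ * (((m ⟨h, hh⟩)ᴴ * (Bᴴ * B) *
          m ⟨h, hh⟩) * ((h⁻¹ : SpecialLinearGroup ι ℂ) : Matrix ι ι ℂ)) *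
            C := by simp only [mul_assoc]
    _ = (Cᴴ * Bᴴ) * B *
          ((h⁻¹ : SpecialLinearGroup ι ℂ) : Matrix ι ι ℂ) * C := by
        rw [hinv]; simp only [mul_assoc]
    _ = _ := by rw [e3, one_mul]

open scoped ComplexOrder in
/-- The trace form is nondegenerate on the span of a finite group of complex matrices. -/
theorem Matrix.SpecialLinearGroup.eq_zero_of_forall_trace_mul_eq_zero
    (H : Subgroup (SpecialLinearGroup ι ℂ)) [Finite H] {X : Matrix ι ι ℂ}
    (hX : X ∈ Submodule.span ℂ ((↑) '' (H : Set (SpecialLinearGroup ι ℂ)) : Set (Matrix ι ι ℂ)))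
    (htr : ∀ h ∈ H, (X * (h : Matrix ι ι ℂ)).trace = 0) : X = 0 := by
  obtain ⟨B, C, e1, e2, hB⟩ := exists_conjTranspose_conj_eq H
  have key : ∀ Z ∈ Submodule.span ℂ
      ((↑) '' (H : Set (SpecialLinearGroup ι ℂ)) : Set (Matrix ι ι ℂ)),
      ((B * X * C) * (B * Z * C)ᴴ).trace = 0 := by
    intro Z hZ
    induction hZ using Submodule.span_induction with
    | mem Z hZ =>
      obtain ⟨h, hh, rfl⟩ := hZ
      rw [hB h hh, ← htr h⁻¹ (inv_mem hh)]
      calc _ = (B * (X * (C * B) *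
            ((h⁻¹ : SpecialLinearGroup ι ℂ) : Matrix ι ι ℂ) * C)).trace := by
            simp only [mul_assoc]
        _ = _ := by rw [trace_mul_comm, e2, mul_one, mul_assoc, e2, mul_one]
    | zero => simp
    | add Y Z _ _ hY hZ => simp [-conjTranspose_mul, mul_add, add_mul, hY, hZ]
    | smul c Z _ hZ => simp [-conjTranspose_mul, hZ]
  have h0 := trace_mul_conjTranspose_self_eq_zero_iff.1 (key X hX)
  calc X = (C * B) * X * (C * B) := by simp [e2]
    _ = C * (B * X * C) * B := by simp only [mul_assoc]
    _ = 0 := by rw [h0]; simp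

attribute [local instance] Matrix.normedAddCommGroup Matrix.normedSpace in
theorem Matrix.SpecialLinearGroup.exists_isCompact_of_torsion
    (H : Subgroup (SpecialLinearGroup ι ℂ)) [Finite H] :
    ∃ K : Set (SpecialLinearGroup ι ℂ), IsCompact K ∧ ∀ g : SpecialLinearGroup ι ℂ,
      (g : Matrix ι ι ℂ) ∈ Submodule.span ℂ
        ((↑) '' (H : Set (SpecialLinearGroup ι ℂ)) : Set (Matrix ι ι ℂ)) →
      (∀ h ∈ H, IsOfFinOrder (g * h)) → g ∈ K := by
  have := Fintype.ofFinite H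
  let V := Submodule.span ℂ ((↑) '' (H : Set (SpecialLinearGroup ι ℂ)) : Set (Matrix ι ι ℂ))
  let m : H → Matrix ι ι ℂ := fun h => ((h : SpecialLinearGroup ι ℂ) : Matrix ι ι ℂ)
  let Φ : V →ₗ[ℂ] (H → ℂ) :=
    LinearMap.pi fun h => (traceLinearMap ι ℂ ℂ ∘ₗ LinearMap.mulRight ℂ (m h)) ∘ₗ V.subtype
  have hΦ : LinearMap.ker Φ = ⊥ := by
    rw [LinearMap.ker_eq_bot']
    intro X hX
    refine Subtype.ext (eq_zero_of_forall_trace_mul_eq_zero H X.2 fun h hh => ?_)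
    exact congrFun hX ⟨h, hh⟩
  obtain ⟨C, -, hC⟩ := Φ.exists_antilipschitzWith hΦ
  refine ⟨(fun g : SpecialLinearGroup ι ℂ => (g : Matrix ι ι ℂ)) ⁻¹'
      Metric.closedBall (0 : Matrix ι ι ℂ) (C * Fintype.card ι),
    isClosedEmbedding_val.isCompact_preimage (isCompact_closedBall _ _), fun g hg hgT => ?_⟩
  change (g : Matrix ι ι ℂ) ∈ Metric.closedBall (0 : Matrix ι ι ℂ) _
  rw [mem_closedBall_zero_iff]
  have h1 := hC.le_mul_dist ⟨g, hg⟩ 0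
  rw [map_zero, dist_zero_right, dist_zero_right] at h1
  refine h1.trans (mul_le_mul_of_nonneg_left ?_ C.2)
  rw [pi_norm_le_iff_of_nonneg (Nat.cast_nonneg _)]
  intro h
  obtain ⟨k, hk, hk1⟩ := isOfFinOrder_iff_pow_eq_one.1 (hgT h h.2)
  refine norm_trace_le_card_of_pow_eq_one hk.ne' ?_
  exact congrArg (fun x : SpecialLinearGroup ι ℂ => (x : Matrix ι ι ℂ)) hk1

/-- The preimage in `SL` of a torsion subgroup of `PGL` is torsion. -/
theorem isOfFinOrder_of_isOfFinOrder_mk_toGL {K : Type*} [Field K]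
    [Nonempty ι] {g : SpecialLinearGroup ι K}
    (hg : IsOfFinOrder (QuotientGroup.mk (SpecialLinearGroup.toGL g) :
      GL ι K ⧸ Subgroup.center (GL ι K))) : IsOfFinOrder g := by
  obtain ⟨k, hk, hk1⟩ := isOfFinOrder_iff_pow_eq_one.1 hg
  rw [← QuotientGroup.mk_pow, QuotientGroup.eq_one_iff, ← map_pow,
    GeneralLinearGroup.mem_center_iff_val_mem_range_scalar] at hk1
  obtain ⟨a, ha⟩ := hk1
  rw [SpecialLinearGroup.coe_GL_coe_matrix] at ha
  have hdet : a ^ Fintype.card ι = 1 := by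
    have := congrArg Matrix.det ha
    rwa [Matrix.SpecialLinearGroup.det_coe, scalar_apply, det_diagonal, Finset.prod_const,
      Finset.card_univ] at this
  refine isOfFinOrder_iff_pow_eq_one.2
    ⟨k * Fintype.card ι, Nat.mul_pos hk Fintype.card_pos, Subtype.ext ?_⟩
  change ((g ^ (k * Fintype.card ι) : SpecialLinearGroup ι K) : Matrix ι ι K) =
    ((1 : SpecialLinearGroup ι K) : Matrix ι ι K)
  rw [pow_mul, Matrix.SpecialLinearGroup.coe_pow, ← ha, ← map_pow, hdet, map_one,
    Matrix.SpecialLinearGroup.coe_one]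

theorem mk_toGL_surjective {K : Type*} [Field K] [IsAlgClosed K] [Nonempty ι] :
    Function.Surjective fun g : SpecialLinearGroup ι K =>
      (QuotientGroup.mk (SpecialLinearGroup.toGL g) : GL ι K ⧸ Subgroup.center (GL ι K)) := by
  intro q
  obtain ⟨A, rfl⟩ := QuotientGroup.mk_surjective q
  obtain ⟨c, hc⟩ := IsAlgClosed.exists_pow_nat_eq (A : Matrix ι ι K).det⁻¹
    (Fintype.card_pos (α := ι))
  have hA := A.det_ne_zero
  refine ⟨⟨c • (A : Matrix ι ι K), by rw [det_smul, hc, inv_mul_cancel₀ hA]⟩, ?_⟩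
  refine (QuotientGroup.eq.2 ?_).symm
  rw [GeneralLinearGroup.mem_center_iff_val_mem_range_scalar]
  refine ⟨c, ?_⟩
  change scalar ι c = ((A⁻¹ : GL ι K) : Matrix ι ι K) * (c • (A : Matrix ι ι K))
  rw [mul_smul_comm, Units.inv_mul,
    scalar_apply, smul_one_eq_diagonal]

/-- A torsion subgroup of `PGL` over the complex numbers is relatively compact. -/
theorem exists_isCompact_superset_of_torsion [Nonempty ι]
    (G : Subgroup (GL ι ℂ ⧸ Subgroup.center (GL ι ℂ))) (hG : ∀ g ∈ G, IsOfFinOrder g) :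
    ∃ K, IsCompact K ∧ (G : Set (GL ι ℂ ⧸ Subgroup.center (GL ι ℂ))) ⊆ K := by
  let π : SpecialLinearGroup ι ℂ →* GL ι ℂ ⧸ Subgroup.center (GL ι ℂ) :=
    (QuotientGroup.mk' _).comp SpecialLinearGroup.toGL
  let T := G.comap π
  have hT : ∀ g ∈ T, IsOfFinOrder g := fun g hg =>
    isOfFinOrder_of_isOfFinOrder_mk_toGL (hG _ hg)
  let m : SpecialLinearGroup ι ℂ → Matrix ι ι ℂ := fun g => g
  obtain ⟨t, htT, -, ht, -⟩ := Submodule.exists_finset_span_eq_linearIndepOn ℂ (m '' T)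
  obtain ⟨s, hsT, hs⟩ := Finset.subset_set_image_iff.1 htT
  have hst : m '' s = t := by rw [← hs, Finset.coe_image]
  have hle : Subgroup.closure (s : Set (SpecialLinearGroup ι ℂ)) ≤ T :=
    (Subgroup.closure_le _).2 hsT
  have : Finite (Subgroup.closure (s : Set (SpecialLinearGroup ι ℂ))) :=
    SpecialLinearGroup.finite_closure_of_torsion s.finite_toSet fun g hg => hT g (hle hg)
  obtain ⟨K, hK, hKmem⟩ := SpecialLinearGroup.exists_isCompact_of_torsion
    (Subgroup.closure (s : Set (SpecialLinearGroup ι ℂ)))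
  have hπ : Continuous π := continuous_quotient_mk'.comp SpecialLinearGroup.continuous_toGL
  refine ⟨π '' K, hK.image hπ, fun q hq => ?_⟩
  obtain ⟨g, rfl⟩ := mk_toGL_surjective q
  refine ⟨g, hKmem g ?_ fun h hh => hT _ (mul_mem hq (hle hh)), rfl⟩
  have h1 : m g ∈ Submodule.span ℂ (m '' T) := Submodule.subset_span ⟨g, hq, rfl⟩
  rw [← ht, ← hst] at h1
  exact Submodule.span_mono (Set.image_mono Subgroup.subset_closure) h1

/-- A discrete torsion subgroup of `PGL` over the complex numbers is finite. -/
theorem Subgroup.finite_of_torsion_of_discrete [Nonempty ι]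
    (G : Subgroup (GL ι ℂ ⧸ Subgroup.center (GL ι ℂ))) [DiscreteTopology G]
    (hG : ∀ g ∈ G, IsOfFinOrder g) :
    (G : Set (GL ι ℂ ⧸ Subgroup.center (GL ι ℂ))).Finite := by
  have : IsClosed (Subgroup.center (GL ι ℂ) : Set (GL ι ℂ)) := by
    rw [Subgroup.coe_center, ← Set.centralizer_univ]
    exact Set.isClosed_centralizer _
  obtain ⟨K, hK, hGK⟩ := exists_isCompact_superset_of_torsion G hG
  have hcl : IsClosed (G : Set (GL ι ℂ ⧸ Subgroup.center (GL ι ℂ))) :=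
    Subgroup.isClosed_of_discrete
  exact (hK.of_isClosed_subset hcl hGK).finite (isDiscrete_iff_discreteTopology.2 ‹_›)

end

/-- A discrete subgroup `G` of `PU(1,n)` is finite if and only if every
element of `G` has finite order. -/
theorem finite_iff_torsion
    (n : ℕ) (hn : 1 ≤ n) (G : Subgroup (PGLn n))
    (hPU : (G : Set (PGLn n)) ⊆ PUset n) (hdisc : DiscreteTopology ↥G) :
    (G : Set (PGLn n)).Finite ↔ ∀ g : G, IsOfFinOrder g := by
  refine ⟨fun h g => ?_, fun h => ?_⟩
  · have : Finite G := h
    exact isOfFinOrder_of_finite g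
  · exact G.finite_of_torsion_of_discrete fun g hg =>
      G.subtype_injective.isOfFinOrder_iff.2 (h ⟨g, hg⟩)
end

section
/- Let n ≥ 1 and let (γ_m) be a sequence in PSL(n+1,ℂ) converging in the sense of quasi-projective transformations to a quasi-projective map γ whose kernel Ker(γ) is a complex projective hyperplane. Let p ∈ Ker(γ) ∖ Im(γ) and let ℓ be a complex projective line with ℓ ∩ Ker(γ) = {p}. Then there exist a subsequence of (γ_m) (still denoted (γ_m)) and a complex projective line ℓ_p such that for every open neighborhood W of p with closure contained in ℙⁿ_ℂ, the set of cluster points of the sequence of sets (γ_m(cl(W) ∩ ℓ)) equals ℓ_p; here z is a cluster point of (γ_m(cl(W) ∩ ℓ)) if there are a subsequence (γ_{m_k}) and points x_k ∈ cl(W) ∩ ℓ with γ_{m_k}(x_k) → z. -/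
open Filter Topology Matrix

namespace Pn

lemma isOpenQuotientMap_mk (n : ℕ) :
    IsOpenQuotientMap (Projectivization.mk' ℂ : {v : Vec n // v ≠ 0} → Pn n) := by
  refine ⟨fun p => ⟨⟨p.rep, p.rep_nonzero⟩, p.mk_rep⟩, continuous_quotient_mk', fun U hU => ?_⟩
  refine isOpen_coinduced.2 ?_
  have key : (Projectivization.mk' ℂ : {v : Vec n // v ≠ 0} → Pn n) ⁻¹'
      (Projectivization.mk' ℂ '' U) = ⋃ c : ℂˣ, (fun v : {v : Vec n // v ≠ 0} =>
        (⟨c • v.1, (smul_ne_zero_iff_ne c).2 v.2⟩ : {v : Vec n // v ≠ 0})) ⁻¹' U := by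
    ext v
    simp only [Set.mem_preimage, Set.mem_image, Set.mem_iUnion]
    constructor
    · rintro ⟨u, hu, huv⟩
      rw [Projectivization.mk'_eq_mk, Projectivization.mk'_eq_mk,
        Projectivization.mk_eq_mk_iff] at huv
      obtain ⟨c, hc⟩ := huv
      exact ⟨c, by convert hu⟩
    · rintro ⟨c, hc⟩
      refine ⟨_, hc, ?_⟩
      rw [Projectivization.mk'_eq_mk, Projectivization.mk'_eq_mk, Projectivization.mk_eq_mk_iff]
      exact ⟨c, rfl⟩
  change IsOpen ((Projectivization.mk' ℂ : {v : Vec n // v ≠ 0} → Pn n) ⁻¹'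
      (Projectivization.mk' ℂ '' U))
  rw [key]
  refine isOpen_iUnion fun c => hU.preimage ?_
  exact (continuous_subtype_val.const_smul c).subtype_mk _

lemma mk_eq_mk_iff_mul {n : ℕ} {v w : Vec n} (hv : v ≠ 0) (hw : w ≠ 0) :
    Projectivization.mk ℂ v hv = Projectivization.mk ℂ w hw ↔ ∀ i j, v i * w j = v j * w i := by
  rw [Projectivization.mk_eq_mk_iff']
  constructor
  · rintro ⟨a, rfl⟩ i j
    simp only [Pi.smul_apply, smul_eq_mul]
    ring
  · intro h
    obtain ⟨j, hj⟩ := Function.ne_iff.1 hw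
    refine ⟨v j / w j, funext fun i => ?_⟩
    have := h i j
    simp only [Pi.zero_apply] at hj
    simp only [Pi.smul_apply, smul_eq_mul]
    field_simp
    linear_combination -this

instance (n : ℕ) : T2Space (Pn n) := by
  rw [t2Space_iff_of_isOpenQuotientMap (isOpenQuotientMap_mk n)]
  simp only [Projectivization.mk'_eq_mk, mk_eq_mk_iff_mul, Set.ofPred_forall]
  refine isClosed_iInter fun i => isClosed_iInter fun j => isClosed_eq ?_ ?_ <;>
    exact ((continuous_apply _).comp (continuous_subtype_val.comp continuous_fst)).mul
      ((continuous_apply _).comp (continuous_subtype_val.comp continuous_snd))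

lemma tendsto_mk {n : ℕ} {α : Type*} {l : Filter α} {v : α → Vec n} {w : Vec n}
    (hv : ∀ a, v a ≠ 0) (hw : w ≠ 0) (h : Tendsto v l (𝓝 w)) :
    Tendsto (fun a => (Projectivization.mk ℂ (v a) (hv a) : Pn n)) l
      (𝓝 (Projectivization.mk ℂ w hw)) := by
  have h' : Tendsto (fun a => (⟨v a, hv a⟩ : {v : Vec n // v ≠ 0})) l (𝓝 ⟨w, hw⟩) :=
    tendsto_subtype_rng.2 h
  exact ((isOpenQuotientMap_mk n).continuous.tendsto _).comp h'

lemma exists_mk_norm_eq_one {n : ℕ} (p : Pn n) :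
    ∃ (v : Vec n) (hv : v ≠ 0), ‖v‖ = 1 ∧ Projectivization.mk ℂ v hv = p := by
  have hr := norm_ne_zero_iff.2 p.rep_nonzero
  have hc : ((‖p.rep‖⁻¹ : ℝ) : ℂ) ≠ 0 := by exact_mod_cast inv_ne_zero hr
  refine ⟨((‖p.rep‖⁻¹ : ℝ) : ℂ) • p.rep, smul_ne_zero hc p.rep_nonzero, ?_, ?_⟩
  · rw [norm_smul, Complex.norm_real, norm_inv, norm_norm, inv_mul_cancel₀ hr]
  · conv_rhs => rw [← p.mk_rep]
    rw [Projectivization.mk_eq_mk_iff']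
    exact ⟨_, rfl⟩

instance (n : ℕ) : CompactSpace (Pn n) := by
  have : CompactSpace (Metric.sphere (0 : Vec n) 1) :=
    isCompact_iff_compactSpace.1 (isCompact_sphere _ _)
  have hne (v : Metric.sphere (0 : Vec n) 1) : v.1 ≠ 0 := by
    have := v.2
    rw [mem_sphere_zero_iff_norm] at this
    exact norm_ne_zero_iff.1 (by simp [this])
  have hs : Function.Surjective
      (fun v : Metric.sphere (0 : Vec n) 1 => Projectivization.mk' ℂ ⟨v.1, hne v⟩) := by
    intro p
    obtain ⟨v, hv, h1, rfl⟩ := exists_mk_norm_eq_one p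
    exact ⟨⟨v, mem_sphere_zero_iff_norm.2 h1⟩, rfl⟩
  exact hs.compactSpace
    ((isOpenQuotientMap_mk n).continuous.comp (continuous_subtype_val.subtype_mk _))

end Pn

lemma mk_mem_projSet {n : ℕ} {L : Submodule ℂ (Vec n)} {v : Vec n} (hv : v ≠ 0) :
    Projectivization.mk ℂ v hv ∈ projSet L ↔ v ∈ L := by
  obtain ⟨a, ha⟩ := Projectivization.exists_smul_eq_mk_rep ℂ v hv
  change (Projectivization.mk ℂ v hv).rep ∈ L ↔ _
  rw [← ha]
  exact L.smul_mem_iff a.ne_zero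

lemma isClosed_projSet {n : ℕ} (L : Submodule ℂ (Vec n)) : IsClosed (projSet L) := by
  rw [← (Pn.isOpenQuotientMap_mk n).isQuotientMap.isClosed_preimage]
  have : Projectivization.mk' ℂ ⁻¹' (projSet L) = {v : {v : Vec n // v ≠ 0} | v.1 ∈ L} := by
    ext v
    exact mk_mem_projSet v.2
  rw [this]
  exact L.closed_of_finiteDimensional.preimage continuous_subtype_val

lemma projSet_injective {n : ℕ} : Function.Injective (projSet (n := n)) := by
  intro L L' h
  ext v
  by_cases hv : v = 0
  · simp [hv]
  · rw [← mk_mem_projSet hv, h, mk_mem_projSet hv]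

/-- The matrix of a representative of `g` in `SL(n+1,ℂ)`. -/
noncomputable def repMat {n : ℕ} (g : PSLn n) : Mat n :=
  (Matrix.SpecialLinearGroup.toGL (Quotient.out g) : GLn n)

lemma repMat_injective {n : ℕ} (g : PSLn n) :
    Function.Injective (Matrix.mulVecLin (repMat g)) := glInj _

lemma repMat_mulVec_ne_zero {n : ℕ} (g : PSLn n) {v : Vec n} (hv : v ≠ 0) :
    repMat g *ᵥ v ≠ 0 :=
  (map_ne_zero_iff (Matrix.mulVecLin (repMat g)) (repMat_injective g)).2 hv

lemma actPSL_mk {n : ℕ} (g : PSLn n) {v : Vec n} (hv : v ≠ 0) :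
    actPSL g (Projectivization.mk ℂ v hv) = Projectivization.mk ℂ (repMat g *ᵥ v)
      (repMat_mulVec_ne_zero g hv) := rfl

/-- The image of a projective subspace under a projective transformation. -/
lemma actPSL_image_projSet {n : ℕ} (g : PSLn n) (L : Submodule ℂ (Vec n)) :
    actPSL g '' projSet L = projSet (L.map (Matrix.mulVecLin (repMat g))) := by
  ext z
  constructor
  · rintro ⟨x, hx, rfl⟩
    induction x using Projectivization.ind with | h v hv =>
    rw [actPSL_mk, mk_mem_projSet]
    exact Submodule.mem_map_of_mem ((mk_mem_projSet hv).1 hx)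
  · induction z using Projectivization.ind with | h w hw =>
    rw [mk_mem_projSet]
    rintro ⟨v, hv, rfl⟩
    have hv0 : v ≠ 0 := by rintro rfl; simp at hw
    exact ⟨Projectivization.mk ℂ v hv0, (mk_mem_projSet hv0).2 hv, rfl⟩

lemma exists_orthonormal_basis {n d : ℕ} (L : Submodule ℂ (Vec n))
    (hL : Module.finrank ℂ L = d) :
    ∃ u : Fin d → Vec n, (∀ i j, star (u i) ⬝ᵥ u j = if i = j then 1 else 0) ∧
      ∀ v, v ∈ L ↔ v = ∑ i, (star (u i) ⬝ᵥ v) • u i := by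
  let e := (WithLp.linearEquiv 2 ℂ (Vec n)).symm
  let L' : Submodule ℂ (EuclideanSpace ℂ (Fin (n + 1))) := L.map (e : Vec n →ₗ[ℂ] _)
  have hL' : Module.finrank ℂ L' = d := by
    rw [← hL]; exact LinearEquiv.finrank_map_eq e L
  let b := (stdOrthonormalBasis ℂ L').reindex (finCongr hL')
  have hin (x y : EuclideanSpace ℂ (Fin (n + 1))) :
      inner ℂ x y = star x.ofLp ⬝ᵥ y.ofLp := by
    rw [EuclideanSpace.inner_eq_star_dotProduct, dotProduct_comm]
  have hmem (i : Fin d) : (b i : EuclideanSpace ℂ (Fin (n + 1))).ofLp ∈ L := by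
    obtain ⟨w, hw, h⟩ := (b i).2
    rw [← h]
    exact hw
  refine ⟨fun i => (b i : EuclideanSpace ℂ (Fin (n + 1))).ofLp, fun i j => ?_, fun v => ?_⟩
  · rw [← hin, ← Submodule.coe_inner, orthonormal_iff_ite.1 b.orthonormal]
  · constructor
    · intro hv
      have := congrArg (fun x : L' => (x : EuclideanSpace ℂ (Fin (n + 1))).ofLp)
        (b.sum_repr' ⟨e v, Submodule.mem_map_of_mem hv⟩)
      simp only [Submodule.coe_inner, hin, Submodule.coe_sum, Submodule.coe_smul,
        WithLp.ofLp_sum, WithLp.ofLp_smul] at this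
      exact this.symm
    · intro hv
      rw [hv]
      exact L.sum_mem fun i _ => L.smul_mem _ (hmem i)

lemma norm_le_one_of_star_dotProduct_self {n : ℕ} {u : Vec n} (h : star u ⬝ᵥ u = 1) :
    ‖u‖ ≤ 1 := by
  have h1 : ∑ i, ‖u i‖ ^ 2 = 1 := by
    have : star u ⬝ᵥ u = ((∑ i, ‖u i‖ ^ 2 : ℝ) : ℂ) := by
      simp [dotProduct, Complex.conj_mul']
    rw [this] at h
    exact_mod_cast h
  refine (pi_norm_le_iff_of_nonneg zero_le_one).2 fun i => ?_
  have h2 := Finset.single_le_sum (f := fun i => ‖u i‖ ^ 2) (fun i _ => sq_nonneg _)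
    (Finset.mem_univ i)
  rw [h1] at h2
  exact (sq_le_one_iff₀ (norm_nonneg _)).1 h2

lemma tendsto_star_dotProduct {n : ℕ} {α : Type*} {l : Filter α} {v w : α → Vec n}
    {v₀ w₀ : Vec n} (hv : Tendsto v l (𝓝 v₀)) (hw : Tendsto w l (𝓝 w₀)) :
    Tendsto (fun k => star (v k) ⬝ᵥ w k) l (𝓝 (star v₀ ⬝ᵥ w₀)) := by
  simp only [dotProduct, Pi.star_apply]
  exact tendsto_finsetSum _ fun i _ =>
    (tendsto_pi_nhds.1 hv i).star.mul (tendsto_pi_nhds.1 hw i)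

lemma star_dotProduct_sum_smul {n d : ℕ} {b : Fin d → Vec n}
    (hb : ∀ i j, star (b i) ⬝ᵥ b j = if i = j then 1 else 0) (c : Fin d → ℂ) (i : Fin d) :
    star (b i) ⬝ᵥ (∑ j, c j • b j) = c i := by
  simp [dotProduct_sum, hb]

lemma linearIndependent_of_star_dotProduct {n d : ℕ} {b : Fin d → Vec n}
    (hb : ∀ i j, star (b i) ⬝ᵥ b j = if i = j then 1 else 0) : LinearIndependent ℂ b := by
  rw [Fintype.linearIndependent_iff]
  intro c hc i
  rw [← star_dotProduct_sum_smul hb c i, hc, dotProduct_zero]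

/-- Every sequence of `d`-dimensional subspaces subconverges, in the sense of Kuratowski, to a
`d`-dimensional subspace. -/
lemma exists_subseq_tendsto_projSet {n d : ℕ} (L : ℕ → Submodule ℂ (Vec n))
    (hL : ∀ k, Module.finrank ℂ (L k) = d) :
    ∃ φ : ℕ → ℕ, StrictMono φ ∧ ∃ E : Submodule ℂ (Vec n), Module.finrank ℂ E = d ∧
      (∀ z ∈ projSet E, ∃ y : ℕ → Pn n, (∀ᶠ k in atTop, y k ∈ projSet (L (φ k))) ∧
        Tendsto y atTop (𝓝 z)) ∧
      (∀ ψ : ℕ → ℕ, StrictMono ψ → ∀ (y : ℕ → Pn n) (z : Pn n),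
        (∀ k, y k ∈ projSet (L (φ (ψ k)))) → Tendsto y atTop (𝓝 z) → z ∈ projSet E) := by
  choose u hu hmem using fun k => exists_orthonormal_basis (L k) (hL k)
  have hbd (k : ℕ) : u k ∈ Metric.closedBall (0 : Fin d → Vec n) 1 := by
    rw [mem_closedBall_zero_iff]
    exact (pi_norm_le_iff_of_nonneg zero_le_one).2 fun i =>
      norm_le_one_of_star_dotProduct_self (by simp [hu])
  obtain ⟨a, -, φ, hφ, ha⟩ := (isCompact_closedBall _ _).tendsto_subseq hbd
  have hai (i : Fin d) : Tendsto (fun k => u (φ k) i) atTop (𝓝 (a i)) :=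
    tendsto_pi_nhds.1 ha i
  have hao (i j : Fin d) : star (a i) ⬝ᵥ a j = if i = j then 1 else 0 := by
    refine tendsto_nhds_unique (tendsto_star_dotProduct (hai i) (hai j)) ?_
    simp only [hu]
    exact tendsto_const_nhds
  refine ⟨φ, hφ, Submodule.span ℂ (Set.range a), by
    simpa using finrank_span_eq_card (linearIndependent_of_star_dotProduct hao), ?_, ?_⟩
  · intro z
    induction z using Projectivization.ind with | h v hv =>
    rw [mk_mem_projSet, Submodule.mem_span_range_iff_exists_fun]
    rintro ⟨c, rfl⟩
    have hne (k : ℕ) : ∑ i, c i • u (φ k) i ≠ 0 := by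
      intro h0
      have hc (i : Fin d) : c i = 0 := by
        rw [← star_dotProduct_sum_smul (hu (φ k)) c i, h0, dotProduct_zero]
      simp [hc] at hv
    refine ⟨fun k => Projectivization.mk ℂ _ (hne k), Eventually.of_forall fun k => ?_,
      Pn.tendsto_mk hne hv (tendsto_finsetSum _ fun i _ => (hai i).const_smul (c i))⟩
    rw [mk_mem_projSet, hmem]
    simp only [star_dotProduct_sum_smul (hu (φ k))]
  · intro ψ hψ y z hy hyz
    choose v hv0 hv1 hvy using fun k => Pn.exists_mk_norm_eq_one (y k)
    obtain ⟨w, hw, θ, hθ, hvw⟩ := (isCompact_sphere (0 : Vec n) 1).tendsto_subseq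
      (x := v) fun k => by simp [hv1]
    have hw0 : w ≠ 0 := ne_zero_of_mem_unit_sphere (⟨w, hw⟩ : Metric.sphere (0 : Vec n) 1)
    have hz : z = Projectivization.mk ℂ w hw0 := by
      refine tendsto_nhds_unique (hyz.comp hθ.tendsto_atTop) ?_
      simpa only [Function.comp_def, hvy] using
        Pn.tendsto_mk (fun k => hv0 (θ k)) hw0 hvw
    have hai' (i : Fin d) : Tendsto (fun k => u (φ (ψ (θ k))) i) atTop (𝓝 (a i)) :=
      (hai i).comp (hψ.comp hθ).tendsto_atTop
    have hvmem (k : ℕ) : v (θ k) =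
        ∑ i, (star (u (φ (ψ (θ k))) i) ⬝ᵥ v (θ k)) • u (φ (ψ (θ k))) i := by
      rw [← hmem, ← mk_mem_projSet (hv0 _), hvy]
      exact hy _
    have hweq : w = ∑ i, (star (a i) ⬝ᵥ w) • a i := by
      refine tendsto_nhds_unique hvw ?_
      simp only [Function.comp_def]
      rw [funext hvmem]
      exact tendsto_finsetSum _ fun i _ => (tendsto_star_dotProduct (hai' i) hvw).smul (hai' i)
    rw [hz, mk_mem_projSet, Submodule.mem_span_range_iff_exists_fun]
    exact ⟨_, hweq.symm⟩

/-- A quasi-projective map whose kernel is a hyperplane is constant off its kernel. -/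
lemma exists_qMap_eq {n : ℕ} {M : Mat n} (hker : IsProjHyperplane (qKer M)) :
    ∃ q : Pn n, ∀ x ∉ qKer M, qMap M x = q := by
  obtain ⟨H, hH, hHM⟩ := hker
  have hker : Module.finrank ℂ (LinearMap.ker (Matrix.mulVecLin M)) = n := by
    rw [projSet_injective hHM, hH]
  have hrange : Module.finrank ℂ (LinearMap.range (Matrix.mulVecLin M)) = 1 := by
    have := LinearMap.finrank_range_add_finrank_ker (Matrix.mulVecLin M)
    rw [hker, Module.finrank_fin_fun] at this
    omega
  obtain ⟨w, hw0, hw⟩ := finrank_eq_one_iff'.1 hrange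
  have hw0' : (w : Vec n) ≠ 0 := by simpa using hw0
  refine ⟨Projectivization.mk ℂ w hw0', fun x hx => ?_⟩
  have hx' : M *ᵥ x.rep ≠ 0 := hx
  rw [qMap, dif_pos hx', Projectivization.mk_eq_mk_iff']
  obtain ⟨c, hc⟩ := hw ⟨M *ᵥ x.rep, x.rep, rfl⟩
  exact ⟨c, congrArg Subtype.val hc⟩

/-- A sequence that converges uniformly on `K` to a constant eventually maps `K` into each
neighborhood of that constant. -/
lemma UnifConvOn.eventually_mem {n : ℕ} {f : ℕ → Pn n → Pn n} {F : Pn n → Pn n}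
    {K : Set (Pn n)} (h : UnifConvOn f F K) {q : Pn n} (hF : ∀ x ∈ K, F x = q)
    {U : Set (Pn n)} (hU : IsOpen U) (hq : q ∈ U) :
    ∀ᶠ m in atTop, ∀ x ∈ K, f m x ∈ U := by
  have hW : IsOpen ({x : Pn n × Pn n | x.1 ≠ q} ∪ {x | x.2 ∈ U}) :=
    (isOpen_ne.preimage continuous_fst).union (hU.preimage continuous_snd)
  filter_upwards [h _ hW fun y => or_iff_not_imp_left.2 fun hy => by
    change ¬ y ≠ q at hy
    rw [not_not] at hy
    exact hy ▸ hq] with m hm x hx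
  exact (hm x hx).resolve_left fun h => h (hF x hx)

/-- Every neighborhood of a point of a projective line meeting a projective subspace only at that
point contains further points of the line, off the subspace. -/
lemma exists_mem_line_notMem {n : ℕ} {L H : Submodule ℂ (Vec n)}
    (hL : Module.finrank ℂ L = 2) {p : Pn n} (hLH : projSet L ∩ projSet H = {p})
    {W : Set (Pn n)} (hW : IsOpen W) (hpW : p ∈ W) :
    ∃ x ∈ W ∩ projSet L, x ∉ projSet H := by
  have hp : p ∈ projSet L ∩ projSet H := hLH ▸ Set.mem_singleton p
  have hpL : p.rep ∈ L := hp.1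
  have hpH : p.rep ∈ H := hp.2
  obtain ⟨w, hwL, hwp⟩ : ∃ w ∈ L, w ∉ Submodule.span ℂ {p.rep} := by
    by_contra! hcon
    have h1 := Submodule.finrank_mono (show L ≤ Submodule.span ℂ {p.rep} from hcon)
    rw [hL, finrank_span_singleton p.rep_nonzero] at h1
    omega
  have hwH : w ∉ H := by
    intro hwH
    have hw0 : w ≠ 0 := by rintro rfl; exact hwp (zero_mem _)
    have hmem : Projectivization.mk ℂ w hw0 ∈ projSet L ∩ projSet H :=
      ⟨(mk_mem_projSet hw0).2 hwL, (mk_mem_projSet hw0).2 hwH⟩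
    rw [hLH, Set.mem_singleton_iff, ← p.mk_rep, Projectivization.mk_eq_mk_iff'] at hmem
    exact hwp (Submodule.mem_span_singleton.2 hmem)
  let c : ℕ → ℂ := fun k => 1 / ((k : ℂ) + 1)
  have hc (k : ℕ) : c k ≠ 0 := one_div_ne_zero (Nat.cast_add_one_ne_zero k)
  have hH (k : ℕ) : p.rep + c k • w ∉ H := fun h =>
    hwH ((H.smul_mem_iff (hc k)).1 ((H.add_mem_iff_right hpH).1 h))
  have hne (k : ℕ) : p.rep + c k • w ≠ 0 := fun h => hH k (h ▸ H.zero_mem)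
  have hlim : Tendsto (fun k => p.rep + c k • w) atTop (𝓝 p.rep) := by
    have := (tendsto_const_nhds (x := p.rep)).add
      ((tendsto_one_div_add_atTop_nhds_zero_nat (𝕜 := ℂ)).smul_const w)
    rwa [zero_smul, add_zero] at this
  have hlim' := Pn.tendsto_mk hne p.rep_nonzero hlim
  rw [p.mk_rep] at hlim'
  obtain ⟨k, hk⟩ := (hlim'.eventually (hW.mem_nhds hpW)).exists
  exact ⟨_, ⟨hk, (mk_mem_projSet (hne k)).2 (L.add_mem hpL (L.smul_mem _ hwL))⟩,
    fun h => hH k ((mk_mem_projSet (hne k)).1 h)⟩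

/-- Let `(γ_m) ⊆ PSL(n+1,ℂ)` converge as quasi-projective
transformations to `γ` with `Ker(γ)` a hyperplane, let `p ∈ Ker(γ) ∖ Im(γ)` and let
`ℓ` be a projective line with `ℓ ∩ Ker(γ) = {p}`.  Then there are a subsequence and a
projective line `ℓ_p` such that for every open neighborhood `W` of `p`, the set of
cluster points of `(γ_m(cl(W) ∩ ℓ))` equals `ℓ_p`. -/
theorem cluster_set_of_line_is_line
    (n : ℕ) (hn : 1 ≤ n) (γ : ℕ → PSLn n) (M : Mat n) (hM : M ≠ 0)
    (hconv : QPConv (fun m => actPSL (γ m)) M) (hker : IsProjHyperplane (qKer M))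
    (p : Pn n) (hp : p ∈ qKer M \ qIm M)
    (ℓ : Set (Pn n)) (hℓ : IsProjLine ℓ) (hℓK : ℓ ∩ qKer M = {p}) :
    ∃ φ : ℕ → ℕ, StrictMono φ ∧ ∃ ℓp : Set (Pn n), IsProjLine ℓp ∧
      ∀ W : Set (Pn n), IsOpen W → p ∈ W →
        {z : Pn n | ∃ ψ : ℕ → ℕ, StrictMono ψ ∧ ∃ x : ℕ → Pn n,
          (∀ k, x k ∈ closure W ∩ ℓ) ∧
          Filter.Tendsto (fun k => actPSL (γ (φ (ψ k))) (x k)) Filter.atTop (nhds z)} = ℓp := by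
  obtain ⟨L, hL, rfl⟩ := hℓ
  obtain ⟨q, hq⟩ := exists_qMap_eq hker
  obtain ⟨φ, hφ, E, hE, hlift, hlim⟩ := exists_subseq_tendsto_projSet (d := 2)
    (fun m => L.map (Matrix.mulVecLin (repMat (γ m)))) fun m => by
      rw [← hL]
      exact (L.equivMapOfInjective _ (repMat_injective _)).finrank_eq.symm
  simp only [← actPSL_image_projSet] at hlift hlim
  refine ⟨φ, hφ, projSet E, ⟨E, hE, rfl⟩, fun W hW hpW => Set.Subset.antisymm ?_ ?_⟩
  · rintro z ⟨ψ, hψ, x, hx, hz⟩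
    exact hlim ψ hψ _ z (fun k => ⟨x k, (hx k).2, rfl⟩) hz
  · intro z hz
    have huniform {K : Set (Pn n)} (hK : IsCompact K) (hKker : K ⊆ (qKer M)ᶜ)
        {U : Set (Pn n)} (hU : IsOpen U) (hqU : q ∈ U) :
        ∀ᶠ k in atTop, ∀ x ∈ K, actPSL (γ (φ k)) x ∈ U :=
      hφ.tendsto_atTop.eventually
        ((hconv K hKker hK).eventually_mem (fun x hx => hq x (hKker hx)) hU hqU)
    by_cases hzq : z = q
    · subst hzq
      obtain ⟨x, hx, hxM⟩ := exists_mem_line_notMem hL hℓK hW hpW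
      refine ⟨id, strictMono_id, fun _ => x, fun _ => ⟨subset_closure hx.1, hx.2⟩, ?_⟩
      refine tendsto_nhds.2 fun U hU hzU => ?_
      filter_upwards [huniform isCompact_singleton (Set.singleton_subset_iff.2 hxM) hU hzU]
        with k hk using hk x rfl
    · obtain ⟨y, hy, hyz⟩ := hlift z hz
      obtain ⟨U, V, hU, hV, hzU, hqV, hUV⟩ := t2_separation hzq
      have hK : IsCompact (projSet L \ W) :=
        ((isClosed_projSet L).sdiff hW).isCompact
      have hKker : projSet L \ W ⊆ (qKer M)ᶜ := fun x hx hxM =>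
        hx.2 ((hℓK ▸ ⟨hx.1, hxM⟩ : x ∈ ({p} : Set (Pn n))) ▸ hpW)
      obtain ⟨N, hN⟩ := eventually_atTop.1
        ((hy.and (huniform hK hKker hV hqV)).and (hyz.eventually (hU.mem_nhds hzU)))
      choose x hxL hxy using fun k => (hN (k + N) (Nat.le_add_left N k)).1.1
      refine ⟨fun k => k + N, strictMono_id.add_const N, x, fun k => ⟨?_, hxL k⟩, ?_⟩
      · by_contra hxW
        obtain ⟨⟨-, h1⟩, h2⟩ := hN (k + N) (Nat.le_add_left N k)
        refine Set.disjoint_left.1 hUV h2 ?_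
        rw [← hxy k]
        exact h1 (x k) ⟨hxL k, fun h => hxW (subset_closure h)⟩
      · simp only [hxy]
        exact hyz.comp (tendsto_add_atTop_nat N)
end
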